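/- Let H be a fixed graph. Then with probability tending to 1 as n → ∞, the hitting time of Hamiltonicity in the random motif graph process equals the hitting time of minimum degree two: τ_H = τ_2, where τ_H = min{i : Ḡ_i(H,n) is Hamiltonian} and τ_2 = min{i : δ(Ḡ_i(H,n)) ≥ 2}. -/

import Mathlib

open Filter

namespace RandomMotif

/-- `G` is a *copy* of `H` in the complete graph on `Fin n`: the image of `H`
under an injection of its vertices into `Fin n`. -/
def IsCopy {k n : ℕ} (H : SimpleGraph (Fin k)) (G : SimpleGraph (Fin n)) : Prop :=
  ∃ f : Fin k ↪ Fin n, G = H.map f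

/-- The type of copies of `H` in `K_n`. -/
abbrev Copy {k : ℕ} (H : SimpleGraph (Fin k)) (n : ℕ) : Type :=
  {G : SimpleGraph (Fin n) // IsCopy H G}

/-- `N`, the total number of copies of `H` in `K_n`. -/
noncomputable def numCopies {k : ℕ} (H : SimpleGraph (Fin k)) (n : ℕ) : ℕ :=
  Nat.card (Copy H n)

/-- A sample of the random motif graph process: a uniformly random ordering
`H_1, H_2, …, H_N` of all copies of `H` in `K_n`. -/
abbrev ProcSample {k : ℕ} (H : SimpleGraph (Fin k)) (n : ℕ) : Type :=
  Fin (numCopies H n) ≃ Copy H n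

/-- The probability (uniform over all orderings of the copies) of the event `P`
for the random motif graph process. -/
noncomputable def procProb {k : ℕ} (H : SimpleGraph (Fin k)) (n : ℕ)
    (P : ProcSample H n → Prop) : ℝ :=
  (Nat.card {ω : ProcSample H n // P ω} : ℝ) / (Nat.card (ProcSample H n) : ℝ)

/-- `Ḡ_i(H,n)`: the union of the first `i` copies of the process. -/
noncomputable def procGraph {k n : ℕ} {H : SimpleGraph (Fin k)} (ω : ProcSample H n)
    (i : ℕ) : SimpleGraph (Fin n) :=
  ⨆ j : Fin (numCopies H n), if (j : ℕ) < i then (ω j).1 else ⊥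

/-- `τ_d`: the hitting time of minimum degree at least `d`. -/
noncomputable def tauDeg {k n : ℕ} {H : SimpleGraph (Fin k)} (d : ℕ)
    (ω : ProcSample H n) : ℕ :=
  sInf {i : ℕ | ∀ v : Fin n, d ≤ ((procGraph ω i).neighborSet v).ncard}

/-- `τ_H`: the hitting time of Hamiltonicity. -/
noncomputable def tauHam {k n : ℕ} {H : SimpleGraph (Fin k)} (ω : ProcSample H n) : ℕ :=
  sInf {i : ℕ | (procGraph ω i).IsHamiltonian}

section Posa
variable {V : Type*} {Γ Γ' : SimpleGraph V}

/-- A list of vertices that traces a path of the graph. -/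
def IsPathList (Γ : SimpleGraph V) (l : List V) : Prop := l.Nodup ∧ l.IsChain Γ.Adj

lemma IsPathList.mono {l : List V} (h : Γ ≤ Γ') (hl : IsPathList Γ l) : IsPathList Γ' l :=
  ⟨hl.1, hl.2.imp fun _ _ hab => h hab⟩

/-- A path, given by its list of vertices, of maximal length. -/
def IsLongestPathList (Γ : SimpleGraph V) (l : List V) : Prop :=
  IsPathList Γ l ∧ ∀ l', IsPathList Γ l' → l'.length ≤ l.length

/-- The lists obtained from `l₀` by repeated Pósa rotations that keep the last vertex fixed. -/
inductive Rotated (Γ : SimpleGraph V) (l₀ : List V) : List V → Prop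
  | refl : Rotated Γ l₀ l₀
  | step {x y : V} {l₂ l₁ : List V} : Rotated Γ l₀ (x :: l₂ ++ y :: l₁) → Γ.Adj x y →
      Rotated Γ l₀ ((x :: l₂).reverse ++ y :: l₁)

/-- `a` is immediately followed by `b` in the list. -/
def Consec (l : List V) (a b : V) : Prop := ∃ i : ℕ, l[i]? = some a ∧ l[i + 1]? = some b

lemma Rotated.perm {l₀ l : List V} (h : Rotated Γ l₀ l) : l.Perm l₀ := by
  induction h with
  | refl => exact List.Perm.refl _
  | step h hxy ih => exact ((List.reverse_perm _).append_right _).trans ih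

lemma Rotated.getLast? {l₀ l : List V} (h : Rotated Γ l₀ l) : l.getLast? = l₀.getLast? := by
  induction h with
  | refl => rfl
  | step h hxy ih => rw [← ih, List.getLast?_append_of_ne_nil _ (by simp), List.getLast?_append_of_ne_nil _ (by simp)]

lemma Rotated.isPathList {l₀ l : List V} (h : Rotated Γ l₀ l) (h₀ : IsPathList Γ l₀) :
    IsPathList Γ l := by
  refine ⟨h.perm.nodup_iff.2 h₀.1, ?_⟩
  induction h with
  | refl => exact h₀.2
  | step h hxy ih =>
    rw [List.isChain_append] at ih ⊢
    refine ⟨?_, ih.2.1, ?_⟩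
    · rw [List.isChain_reverse]
      simpa only [Γ.adj_comm] using ih.1
    · simpa using hxy

lemma consec_append {A B : List V} {a b : V} (h : Consec (A ++ B) a b) :
    Consec A a b ∨ Consec B a b ∨ (A.getLast? = some a ∧ B.head? = some b) := by
  obtain ⟨i, h1, h2⟩ := h
  rw [List.getElem?_append] at h1 h2
  by_cases h3 : i + 1 < A.length
  · rw [if_pos (by omega)] at h1
    rw [if_pos h3] at h2
    exact Or.inl ⟨i, h1, h2⟩
  by_cases h4 : i < A.length
  · rw [if_pos h4] at h1
    rw [if_neg h3] at h2
    refine Or.inr (Or.inr ⟨?_, ?_⟩)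
    · rw [List.getLast?_eq_getElem?, ← h1]; congr 1; omega
    · rw [List.head?_eq_getElem?, ← h2]; congr 1; omega
  · rw [if_neg h4] at h1
    rw [if_neg h3] at h2
    exact Or.inr (Or.inl ⟨i - A.length, h1, by rw [← h2]; congr 1; omega⟩)

lemma Consec.append_left {A B : List V} {a b : V} (h : Consec A a b) : Consec (A ++ B) a b := by
  obtain ⟨i, h1, h2⟩ := h
  refine ⟨i, ?_, ?_⟩ <;> rw [List.getElem?_append_left] <;> grind

lemma Consec.append_right {A B : List V} {a b : V} (h : Consec B a b) : Consec (A ++ B) a b := by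
  obtain ⟨i, h1, h2⟩ := h
  refine ⟨A.length + i, ?_, ?_⟩ <;> grind

lemma Consec.reverse {A : List V} {a b : V} (h : Consec A a b) : Consec A.reverse b a := by
  obtain ⟨i, h1, h2⟩ := h
  refine ⟨A.length - 2 - i, ?_, ?_⟩ <;> grind

lemma Consec.middle {A B : List V} {a b : V} (ha : A.getLast? = some a) :
    Consec (A ++ b :: B) a b := by
  refine ⟨A.length - 1, ?_, ?_⟩ <;> grind

lemma Consec.left_unique {l : List V} (hl : l.Nodup) {a a' b : V} (h : Consec l a b)
    (h' : Consec l a' b) : a = a' := by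
  obtain ⟨i, h1, h2⟩ := h
  obtain ⟨j, h3, h4⟩ := h'
  have := List.nodup_iff_injective_getElem.1 hl
  have hi : i + 1 < l.length := by grind
  have hj : j + 1 < l.length := by grind
  have : (⟨i + 1, hi⟩ : Fin l.length) = ⟨j + 1, hj⟩ := this (by grind)
  grind

lemma Consec.right_unique {l : List V} (hl : l.Nodup) {a b b' : V} (h : Consec l a b)
    (h' : Consec l a b') : b = b' := by
  obtain ⟨i, h1, h2⟩ := h
  obtain ⟨j, h3, h4⟩ := h'
  have := List.nodup_iff_injective_getElem.1 hl
  have hi : i < l.length := by grind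
  have hj : j < l.length := by grind
  have : (⟨i, hi⟩ : Fin l.length) = ⟨j, hj⟩ := this (by grind)
  grind

lemma not_consec_head {x : V} {l : List V} (hl : (x :: l).Nodup) (a : V) :
    ¬ Consec (x :: l) a x := by
  rintro ⟨i, h1, h2⟩
  have : x ∈ l := by
    rw [List.getElem?_cons_succ] at h2
    exact List.mem_of_getElem? h2
  exact (List.nodup_cons.1 hl).1 this

/-- The free endpoints of the rotations of `l₀`. -/
def rotationEnds (Γ : SimpleGraph V) (l₀ : List V) : Set V :=
  {z | ∃ l, Rotated Γ l₀ l ∧ l.head? = some z}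

lemma Rotated.consec {l₀ l : List V} (h : Rotated Γ l₀ l) {y : V}
    (hy : y ∉ rotationEnds Γ l₀) {w : V} (hw : Consec l w y ∨ Consec l y w) :
    (Consec l₀ w y ∨ Consec l₀ y w) ∨
      ∃ z ∈ rotationEnds Γ l₀, Consec l₀ z y ∨ Consec l₀ y z := by
  induction h generalizing w with
  | refl => exact Or.inl hw
  | @step x y' l₂ l₁ h hxy ih =>
    have hx : x ∈ rotationEnds Γ l₀ := ⟨_, h, rfl⟩
    obtain ⟨w', hw'⟩ : ∃ w', (x :: l₂).getLast? = some w' := ⟨_, List.getLast?_eq_getLast_of_ne_nil (by simp)⟩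
    have hw'S : w' ∈ rotationEnds Γ l₀ := ⟨_, h.step hxy, by
      rw [List.head?_append, List.head?_reverse, hw']; rfl⟩
    have key : y = y' → (Consec l₀ w y ∨ Consec l₀ y w) ∨
      ∃ z ∈ rotationEnds Γ l₀, Consec l₀ z y ∨ Consec l₀ y z := by
      rintro rfl
      rcases ih (Or.inl (Consec.middle hw')) with h1 | h1
      · exact Or.inr ⟨w', hw'S, h1⟩
      · exact Or.inr h1
    rcases hw with hw | hw
    · rcases consec_append hw with h1 | h1 | ⟨h1, h2⟩
      · have := h1.reverse
        rw [List.reverse_reverse] at this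
        exact ih (Or.inr this.append_left)
      · exact ih (Or.inl h1.append_right)
      · exact key (by simpa using h2.symm)
    · rcases consec_append hw with h1 | h1 | ⟨h1, h2⟩
      · have := h1.reverse
        rw [List.reverse_reverse] at this
        exact ih (Or.inl this.append_left)
      · exact ih (Or.inr h1.append_right)
      · have : x = y := by simpa using h1
        exact absurd (this ▸ hx) hy

lemma IsLongestPathList.rotated {l₀ l : List V} (h₀ : IsLongestPathList Γ l₀)
    (h : Rotated Γ l₀ l) : IsLongestPathList Γ l :=
  ⟨h.isPathList h₀.1, fun l' hl' => by rw [h.perm.length_eq]; exact h₀.2 l' hl'⟩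

lemma IsLongestPathList.mem_of_adj {x y : V} {l : List V} (h : IsLongestPathList Γ (x :: l))
    (hxy : Γ.Adj x y) : y ∈ x :: l := by
  by_contra hy
  have := h.2 (y :: x :: l) ⟨List.nodup_cons.2 ⟨hy, h.1.1⟩, by
    rw [List.isChain_cons_cons]; exact ⟨hxy.symm, h.1.2⟩⟩
  simp at this

/-- Every outer neighbour of the set of rotation ends is next to a rotation end on `l₀`. -/
lemma exists_consec_of_adj_rotationEnds {l₀ : List V} (h₀ : IsLongestPathList Γ l₀) {x y : V}
    (hx : x ∈ rotationEnds Γ l₀) (hxy : Γ.Adj x y) (hy : y ∉ rotationEnds Γ l₀) :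
    ∃ z ∈ rotationEnds Γ l₀, Consec l₀ z y ∨ Consec l₀ y z := by
  obtain ⟨l, hl, hlx⟩ := hx
  cases l with
  | nil => simp at hlx
  | cons x' l =>
    obtain rfl : x' = x := by simpa using hlx
    have hm := (h₀.rotated hl).mem_of_adj hxy
    have hyx : y ∈ l := (List.mem_cons.1 hm).resolve_left hxy.ne'
    obtain ⟨l₂, l₁, rfl⟩ := List.append_of_mem hyx
    obtain ⟨w, hw⟩ : ∃ w, (x' :: l₂).getLast? = some w :=
      ⟨_, List.getLast?_eq_getLast_of_ne_nil (by simp)⟩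
    have hwS : w ∈ rotationEnds Γ l₀ := ⟨_, Rotated.step (l₂ := l₂) hl hxy, by
      rw [List.head?_append, List.head?_reverse, hw]; rfl⟩
    rcases hl.consec hy (w := w) (Or.inl (Consec.middle (A := x' :: l₂) hw)) with h | h
    · exact ⟨w, hwS, h⟩
    · exact h

variable [Fintype V]

open Classical in
/-- The vertices adjacent to some vertex of `U`. -/
noncomputable def nbrs (Γ : SimpleGraph V) (U : Finset V) : Finset V :=
  Finset.univ.filter fun y => ∃ x ∈ U, Γ.Adj x y

lemma mem_nbrs {U : Finset V} {y : V} : y ∈ nbrs Γ U ↔ ∃ x ∈ U, Γ.Adj x y := by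
  simp [nbrs]

/-- Sets of at most a quarter of the vertices have at least twice as many outer neighbours. -/
def Expands [DecidableEq V] (Γ : SimpleGraph V) : Prop :=
  ∀ U : Finset V, 4 * U.card ≤ Fintype.card V → 2 * U.card ≤ (nbrs Γ U \ U).card

open Classical in
/-- Pósa's lemma. -/
lemma card_nbrs_rotationEnds [DecidableEq V] {x : V} {l : List V} (h₀ : IsLongestPathList Γ (x :: l))
    {S : Finset V} (hS : ∀ z, z ∈ S ↔ z ∈ rotationEnds Γ (x :: l)) :
    (nbrs Γ S \ S).card < 2 * S.card := by
  have hxS : x ∈ S := (hS x).2 ⟨_, Rotated.refl, rfl⟩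
  set A := Finset.univ.filter fun y => ∃ z ∈ S, Consec (x :: l) z y
  set B := Finset.univ.filter fun y => ∃ z ∈ S, Consec (x :: l) y z
  have hsub : nbrs Γ S \ S ⊆ A ∪ B := by
    intro y hy
    rw [Finset.mem_sdiff, mem_nbrs] at hy
    obtain ⟨⟨u, hu, huy⟩, hyS⟩ := hy
    obtain ⟨z, hz, h⟩ := exists_consec_of_adj_rotationEnds h₀ ((hS u).1 hu) huy
      (fun h => hyS ((hS y).2 h))
    simp only [Finset.mem_union, A, B, Finset.mem_filter, Finset.mem_univ, true_and]
    rcases h with h | h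
    · exact Or.inl ⟨z, (hS z).2 hz, h⟩
    · exact Or.inr ⟨z, (hS z).2 hz, h⟩
  have hA : A.card ≤ S.card := by
    have : ∀ y ∈ A, ∃ z ∈ S, Consec (x :: l) z y := by simp [A]
    choose! f hf hf' using this
    refine Finset.card_le_card_of_injOn f hf ?_
    intro y hy y' hy' h
    exact (hf' y hy).right_unique h₀.1.1 (h ▸ hf' y' hy')
  have hB : B.card ≤ (S.erase x).card := by
    have : ∀ y ∈ B, ∃ z ∈ S.erase x, Consec (x :: l) y z := by
      intro y hy
      obtain ⟨z, hz, h⟩ := (Finset.mem_filter.1 hy).2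
      refine ⟨z, Finset.mem_erase.2 ⟨?_, hz⟩, h⟩
      rintro rfl
      exact not_consec_head h₀.1.1 _ h
    choose! f hf hf' using this
    refine Finset.card_le_card_of_injOn f hf ?_
    intro y hy y' hy' h
    exact (hf' y hy).left_unique h₀.1.1 (h ▸ hf' y' hy')
  have h1 := (Finset.card_le_card hsub).trans (Finset.card_union_le A B)
  rw [Finset.card_erase_of_mem hxS] at hB
  have := Finset.card_pos.2 ⟨x, hxS⟩
  omega

lemma Expands.card_rotationEnds [DecidableEq V] (hΓ : Expands Γ) {x : V} {l : List V}
    (h₀ : IsLongestPathList Γ (x :: l)) {S : Finset V}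
    (hS : ∀ z, z ∈ S ↔ z ∈ rotationEnds Γ (x :: l)) : Fintype.card V < 4 * S.card := by
  by_contra! h
  have := hΓ S h
  have := card_nbrs_rotationEnds h₀ hS
  omega

lemma Expands.exists_adj_compl [DecidableEq V] (hΓ : Expands Γ) (hV : 12 ≤ Fintype.card V) {S : Finset V}
    (hS : S.Nonempty) (hS' : ∃ z, z ∉ S) : ∃ y ∈ S, ∃ z, z ∉ S ∧ Γ.Adj y z := by
  by_contra! hno
  have key : ∀ S : Finset V, S.Nonempty → 2 * S.card ≤ Fintype.card V →
      (∀ y ∈ S, ∀ z, z ∉ S → ¬ Γ.Adj y z) → False := by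
    intro S hS hc hno
    obtain ⟨U, hU, hUc⟩ : ∃ U ⊆ S, U.card = min S.card (Fintype.card V / 4) :=
      Finset.exists_subset_card_eq (by omega)
    have h1 := hΓ U (by omega)
    have h2 : nbrs Γ U \ U ⊆ S \ U := by
      refine Finset.sdiff_subset_sdiff (fun y hy => ?_) le_rfl
      obtain ⟨x, hx, hxy⟩ := mem_nbrs.1 hy
      by_contra hyS
      exact hno x (hU hx) y hyS hxy
    have h3 := Finset.card_le_card h2
    rw [Finset.card_sdiff_of_subset hU] at h3
    have := hS.card_pos
    omega
  rcases le_total (2 * S.card) (Fintype.card V) with h | h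
  · exact key S hS h hno
  · refine key Sᶜ ?_ ?_ ?_
    · obtain ⟨z, hz⟩ := hS'; exact ⟨z, by simpa using hz⟩
    · rw [Finset.card_compl]; omega
    · intro y hy z hz hyz
      exact hno z (by simpa using hz) y (by simpa using hy) hyz.symm

lemma isHamiltonian_of_list [DecidableEq V] {x y : V} {l : List V} (hl : IsPathList Γ (x :: l))
    (hlast : (x :: l).getLast? = some y) (hyx : Γ.Adj y x) (hall : ∀ v, v ∈ x :: l)
    (hV : 3 ≤ Fintype.card V) : Γ.IsHamiltonian := by
  intro _
  have hne : x :: l ≠ [] := by simp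
  let p := SimpleGraph.Walk.ofSupport (x :: l) hne hl.2
  have hp : p.support = x :: l := SimpleGraph.Walk.support_ofSupport hne hl.2
  have hlen : (x :: l).length = Fintype.card V := by
    rw [← List.toFinset_card_of_nodup hl.1, ← Finset.card_univ]
    congr 1
    ext v; simpa using hall v
  have hpp : p.IsPath := by rw [SimpleGraph.Walk.isPath_def, hp]; exact hl.1
  have hy : (x :: l).getLast hne = y := by
    rw [List.getLast?_eq_getLast_of_ne_nil hne] at hlast; simpa using hlast
  have hadj : Γ.Adj ((x :: l).getLast hne) ((x :: l).head hne) := by rw [hy]; exact hyx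
  refine ⟨_, SimpleGraph.Walk.cons hadj p, ?_⟩
  rw [SimpleGraph.Walk.isHamiltonianCycle_iff_isCycle_and_length_eq]
  have hpl : p.length + 1 = Fintype.card V := by
    rw [← SimpleGraph.Walk.length_support, hp, hlen]
  refine ⟨?_, hpl⟩
  rw [SimpleGraph.Walk.cons_isCycle_iff]
  refine ⟨hpp, ?_⟩
  intro he
  have := hpp.length_eq_one_of_mem_edges (by rwa [Sym2.eq_swap])
  omega

/-- The largest number of vertices on a path. -/
noncomputable def pathOrder (Γ : SimpleGraph V) : ℕ :=
  sSup {m | ∃ l, IsPathList Γ l ∧ l.length = m}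

lemma pathOrder_bddAbove (Γ : SimpleGraph V) :
    BddAbove {m | ∃ l, IsPathList Γ l ∧ l.length = m} := by
  refine ⟨Fintype.card V, ?_⟩
  rintro _ ⟨l, hl, rfl⟩
  exact hl.1.length_le_card

lemma IsPathList.length_le {l : List V} (hl : IsPathList Γ l) : l.length ≤ pathOrder Γ :=
  le_csSup (pathOrder_bddAbove Γ) ⟨l, hl, rfl⟩

lemma exists_isLongestPathList (Γ : SimpleGraph V) :
    ∃ l, IsLongestPathList Γ l ∧ l.length = pathOrder Γ := by
  obtain ⟨l, hl, h⟩ := Nat.sSup_mem (s := {m | ∃ l, IsPathList Γ l ∧ l.length = m})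
    ⟨0, [], ⟨List.nodup_nil, List.isChain_nil⟩, rfl⟩ (pathOrder_bddAbove Γ)
  exact ⟨l, ⟨hl, fun l' hl' => h ▸ hl'.length_le⟩, h⟩

lemma IsLongestPathList.length_eq {l : List V} (h : IsLongestPathList Γ l) :
    l.length = pathOrder Γ := by
  obtain ⟨l', hl', h'⟩ := exists_isLongestPathList Γ
  exact le_antisymm h.1.length_le (h' ▸ h.2 l' hl'.1)

lemma pathOrder_le_card (Γ : SimpleGraph V) : pathOrder Γ ≤ Fintype.card V := by
  obtain ⟨l, hl, h⟩ := exists_isLongestPathList Γ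
  exact h ▸ hl.1.1.length_le_card

/-- An edge whose addition creates a Hamilton cycle or a longer path. -/
def IsBooster [DecidableEq V] (Γ : SimpleGraph V) (b c : V) : Prop :=
  b ≠ c ∧ ∀ Δ, Γ ≤ Δ → Δ.Adj b c → Δ.IsHamiltonian ∨ pathOrder Γ < pathOrder Δ

/-- Closing a longest path of an expander to a cycle. -/
lemma Expands.hamiltonian_or_lt [DecidableEq V] (hΓ : Expands Γ) (hV : 12 ≤ Fintype.card V)
    {x y : V} {l : List V} (hl : IsLongestPathList Γ (x :: l))
    (hlast : (x :: l).getLast? = some y) (hle : Γ ≤ Γ') (hyx : Γ'.Adj y x) :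
    Γ'.IsHamiltonian ∨ pathOrder Γ < pathOrder Γ' := by
  by_cases hall : ∀ v, v ∈ x :: l
  · exact Or.inl (isHamiltonian_of_list (hl.1.mono hle) hlast hyx hall (by omega))
  right
  push Not at hall
  obtain ⟨z₀, hz₀⟩ := hall
  obtain ⟨v, hv, z, hz, hvz⟩ := hΓ.exists_adj_compl hV (S := (x :: l).toFinset) ⟨x, by simp⟩
    ⟨z₀, by simpa using hz₀⟩
  rw [List.mem_toFinset] at hv hz
  have hp := hl.1.mono hle
  obtain ⟨l₁, l₂, he⟩ := List.append_of_mem hv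
  rw [← hl.length_eq]
  have hperm : (v :: l₂ ++ l₁).Perm (x :: l) := by rw [he]; exact List.perm_append_comm
  have hch : (v :: l₂ ++ l₁).IsChain Γ'.Adj := by
    have h1 := hp.2
    rw [he, List.isChain_append] at h1
    rw [List.isChain_append]
    refine ⟨h1.2.1, h1.1, ?_⟩
    intro a ha b hb
    have hxb : b = x := by
      cases l₁ with
      | nil => simp at hb
      | cons c l₁ =>
        simp at he hb
        rw [← hb, ← he.1]
    have hya : a = y := by
      rw [he, List.getLast?_append_of_ne_nil _ (by simp), Option.mem_def.1 ha] at hlast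
      simpa using hlast
    rw [hxb, hya]; exact hyx
  have hz' : z ∉ v :: l₂ ++ l₁ := fun h => hz (hperm.mem_iff.1 h)
  have : IsPathList Γ' (z :: (v :: l₂ ++ l₁)) :=
    ⟨List.nodup_cons.2 ⟨hz', hperm.nodup_iff.2 hp.1⟩, by
      rw [List.cons_append, List.isChain_cons_cons]; exact ⟨(hle hvz).symm, hch⟩⟩
  have := this.length_le
  rw [List.length_cons, hperm.length_eq] at this
  omega

open Classical in
/-- An expander has quadratically many boosters. -/
lemma Expands.card_boosters [DecidableEq V] (hΓ : Expands Γ) (hV : 12 ≤ Fintype.card V) :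
    Fintype.card V ^ 2 ≤
      16 * (Finset.univ.filter fun e : V × V => IsBooster Γ e.1 e.2).card := by
  obtain ⟨l, hl, -⟩ := exists_isLongestPathList Γ
  have hVne : 0 < Fintype.card V := by omega
  obtain ⟨v₀⟩ := Fintype.card_pos_iff.1 hVne
  obtain ⟨x, l, rfl⟩ : ∃ x l', l = x :: l' := by
    cases l with
    | nil => simpa using hl.2 [v₀] ⟨by simp, by simp⟩
    | cons x l => exact ⟨x, l, rfl⟩
  set S : Finset V := Finset.univ.filter fun z => z ∈ rotationEnds Γ (x :: l) with hSdef
  have hS : ∀ z, z ∈ S ↔ z ∈ rotationEnds Γ (x :: l) := by simp [hSdef]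
  have hScard := hΓ.card_rotationEnds hl hS
  have key : ∀ b ∈ S, ∃ T : Finset V, Fintype.card V ≤ 4 * T.card ∧ ∀ c ∈ T, IsBooster Γ b c := by
    intro b hb
    obtain ⟨l', hl', hb'⟩ := (hS b).1 hb
    have hL := hl.rotated hl'
    have hrev : IsLongestPathList Γ l'.reverse := by
      refine ⟨⟨List.nodup_reverse.2 hL.1.1, ?_⟩, by simpa using hL.2⟩
      rw [List.isChain_reverse]
      simpa only [Γ.adj_comm] using hL.1.2
    have hlast : l'.reverse.getLast? = some b := by rw [List.getLast?_reverse, hb']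
    obtain ⟨x', m, hm⟩ : ∃ x' m, l'.reverse = x' :: m := by
      cases h : l'.reverse with
      | nil => simp [h] at hlast
      | cons x' m => exact ⟨x', m, rfl⟩
    rw [hm] at hrev hlast
    set T : Finset V := Finset.univ.filter fun z => z ∈ rotationEnds Γ (x' :: m) with hTdef
    have hT : ∀ z, z ∈ T ↔ z ∈ rotationEnds Γ (x' :: m) := by simp [hTdef]
    refine ⟨T, (hΓ.card_rotationEnds hrev hT).le, ?_⟩
    intro c hc
    obtain ⟨q, hq, hqc⟩ := (hT c).1 hc
    have hqL := hrev.rotated hq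
    have hqlast := hq.getLast?.trans hlast
    obtain ⟨m', rfl⟩ : ∃ m', q = c :: m' := by
      cases q with
      | nil => simp at hqc
      | cons a m' => exact ⟨m', by simpa using hqc⟩
    refine ⟨?_, fun Γ' hle hadj => hΓ.hamiltonian_or_lt hV hqL hqlast hle hadj⟩
    rintro rfl
    have hm' : m' = [] := by
      by_contra hne
      rw [List.getLast?_cons_of_ne_nil hne] at hqlast
      exact (List.nodup_cons.1 hqL.1.1).1 (List.mem_of_getLast? hqlast)
    subst hm'
    obtain ⟨y, -, z, hz, hyz⟩ := hΓ.exists_adj_compl hV (S := {v₀}) ⟨v₀, by simp⟩ (by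
      by_contra! h
      have : Fintype.card V ≤ 1 := by
        rw [← Finset.card_univ, ← Finset.card_singleton v₀]
        exact Finset.card_le_card fun z _ => h z
      omega)
    have := hqL.2 [y, z] ⟨by simp [hyz.ne], by simp [hyz]⟩
    simp at this
  choose! T hT hT' using key
  have : (S.sigma T).card ≤ (Finset.univ.filter fun e : V × V => IsBooster Γ e.1 e.2).card := by
    refine Finset.card_le_card_of_injOn (fun e => (e.1, e.2)) ?_ ?_
    · rintro ⟨b, c⟩ h
      simp only [Finset.mem_coe, Finset.mem_sigma] at h
      simpa using hT' b h.1 c h.2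
    · rintro ⟨b, c⟩ _ ⟨b', c'⟩ _ h
      simpa using h
  rw [Finset.card_sigma] at this
  have h2 : S.card * Fintype.card V ≤ 4 * ∑ b ∈ S, (T b).card := by
    rw [Finset.mul_sum, ← smul_eq_mul]
    exact Finset.card_nsmul_le_sum _ _ _ hT
  nlinarith

end Posa

section Bijections
variable {ι α β : Type*} [Fintype ι] [Fintype α] [DecidableEq ι] [DecidableEq α]

/-- The probability of an event for a uniformly random bijection. -/
noncomputable def pr {ι α : Type*} (P : (ι ≃ α) → Prop) : ℝ :=
  (Nat.card {ω // P ω} : ℝ) / (Nat.card (ι ≃ α) : ℝ)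

/-- `f σ` is determined by the values of `σ` on `Q`. -/
def DeterminedOn {ι α β : Type*} (Q : Finset ι) (f : (ι ≃ α) → β) : Prop :=
  ∀ σ σ' : ι ≃ α, (∀ q ∈ Q, σ q = σ' q) → f σ = f σ'

lemma pr_eq (P : (ι ≃ α) → Prop) [DecidablePred P] :
    pr P = ((Finset.univ.filter P).card : ℝ) / (Fintype.card (ι ≃ α) : ℝ) := by
  rw [pr, Nat.card_eq_fintype_card, Nat.card_eq_fintype_card, Fintype.card_subtype]

lemma pr_nonneg {ι α : Type*} (P : (ι ≃ α) → Prop) : 0 ≤ pr P := by unfold pr; positivity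

lemma pr_mono {P P' : (ι ≃ α) → Prop} (h : ∀ σ, P σ → P' σ) : pr P ≤ pr P' := by
  classical
  rw [pr_eq, pr_eq]
  gcongr
  exact h _

lemma pr_le_one (P : (ι ≃ α) → Prop) : pr P ≤ 1 := by
  classical
  rw [pr_eq]
  refine div_le_one_of_le₀ ?_ (by positivity)
  exact_mod_cast Finset.card_le_univ _

lemma pr_exists_le (s : Finset β) (P : β → (ι ≃ α) → Prop) :
    pr (fun σ => ∃ b ∈ s, P b σ) ≤ ∑ b ∈ s, pr (P b) := by
  classical
  simp_rw [pr_eq]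
  rw [← Finset.sum_div]
  gcongr
  refine le_trans (Nat.cast_le.2 (Finset.card_le_card (t := s.biUnion fun b =>
    Finset.univ.filter (P b)) fun σ hσ => by simpa using hσ)) ?_
  exact_mod_cast Finset.card_biUnion_le

lemma pr_or_le (P P' : (ι ≃ α) → Prop) : pr (fun σ => P σ ∨ P' σ) ≤ pr P + pr P' := by
  classical
  simp_rw [pr_eq]
  rw [← add_div]
  gcongr
  refine le_trans (Nat.cast_le.2 (Finset.card_le_card (t := Finset.univ.filter P ∪
    Finset.univ.filter P') fun σ hσ => by simpa using hσ)) ?_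
  exact_mod_cast Finset.card_union_le _ _

lemma pr_not [Nonempty (ι ≃ α)] (P : (ι ≃ α) → Prop) : pr (fun σ => ¬ P σ) = 1 - pr P := by
  classical
  rw [pr_eq, pr_eq, eq_sub_iff_add_eq, ← add_div, div_eq_one_iff_eq (by positivity)]
  rw [add_comm]
  have := Finset.card_filter_add_card_filter_not (s := Finset.univ) P
  rw [Finset.card_univ] at this
  rw [← this]
  push_cast
  congr!

lemma pr_congr {ι α : Type*} {P P' : (ι ≃ α) → Prop} (h : ∀ σ, P σ ↔ P' σ) : pr P = pr P' := by
  rw [funext fun σ => propext (h σ)]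

open Classical in
/-- Conditionally on the values on `Q`, the value at a further position is uniformly distributed
over the unused elements. -/
lemma card_filter_apply_mem {Q : Finset ι} {r : ι} (hr : r ∉ Q) {A : (ι ≃ α) → Prop}
    {B : (ι ≃ α) → Finset α} (hA : DeterminedOn Q A) (hB : DeterminedOn Q B) :
    (Fintype.card ι - Q.card) * (Finset.univ.filter fun σ => A σ ∧ σ r ∈ B σ).card =
      ∑ σ ∈ Finset.univ.filter A, (B σ \ Q.image σ).card := by
  have h1 : ∀ σ : ι ≃ α, (B σ \ Q.image σ).card = ∑ j ∈ Qᶜ, if σ j ∈ B σ then 1 else 0 := by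
    intro σ
    rw [← Finset.card_filter]
    have : B σ \ Q.image σ = (Qᶜ.filter fun j => σ j ∈ B σ).image σ := by
      ext c
      simp only [Finset.mem_sdiff, Finset.mem_image, Finset.mem_filter, Finset.mem_compl, not_exists,
        not_and]
      constructor
      · rintro ⟨h, h'⟩
        exact ⟨σ.symm c, ⟨fun hc => h' _ hc (by simp), by simpa using h⟩, by simp⟩
      · rintro ⟨j, ⟨hj, hj'⟩, rfl⟩
        exact ⟨hj', fun q hq h => hj (σ.injective h ▸ hq)⟩
    rw [this, Finset.card_image_of_injective _ σ.injective]
  simp_rw [h1]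
  rw [Finset.sum_comm, ← Finset.card_compl]
  rw [← smul_eq_mul, ← Finset.sum_const]
  refine Finset.sum_congr rfl fun j hj => ?_
  rw [← Finset.card_filter, Finset.filter_filter]
  have hj : j ∉ Q := by simpa using hj
  have hfix : ∀ σ : ι ≃ α, ∀ q ∈ Q, ((Equiv.swap r j).trans σ) q = σ q := by
    intro σ q hq
    rw [Equiv.trans_apply, Equiv.swap_apply_of_ne_of_ne]
    · rintro rfl; exact hr hq
    · rintro rfl; exact hj hq
  refine Finset.card_bij (fun σ _ => (Equiv.swap r j).trans σ) ?_ ?_ ?_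
  · intro σ hσ
    simp only [Finset.mem_filter, Finset.mem_univ, true_and] at hσ ⊢
    rw [hA _ σ (hfix σ), hB _ σ (hfix σ)]
    simpa using hσ
  · intro σ _ σ' _ h
    ext x
    have := DFunLike.congr_fun h (Equiv.swap r j x)
    simpa using this
  · intro σ hσ
    refine ⟨(Equiv.swap r j).trans σ, ?_, ?_⟩
    · simp only [Finset.mem_filter, Finset.mem_univ, true_and] at hσ ⊢
      rw [hA _ σ (hfix σ), hB _ σ (hfix σ)]
      simpa using hσ
    · ext x; simp

lemma pr_apply_mem_le {Q : Finset ι} {r : ι} (hr : r ∉ Q) {A : (ι ≃ α) → Prop}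
    {B : (ι ≃ α) → Finset α} (hA : DeterminedOn Q A) (hB : DeterminedOn Q B) {b q : ℝ}
    (hb : ∀ σ, A σ → ((B σ).card : ℝ) ≤ b) (hQ : (Q.card : ℝ) ≤ q) (hq : q < Fintype.card ι) :
    pr (fun σ => A σ ∧ σ r ∈ B σ) ≤ b / (Fintype.card ι - q) * pr A := by
  classical
  have h := card_filter_apply_mem hr hA hB
  have hcard : Q.card ≤ Fintype.card ι := Finset.card_le_univ Q
  have h2 : ((Fintype.card ι : ℝ) - Q.card) *
      ((Finset.univ.filter fun σ => A σ ∧ σ r ∈ B σ).card : ℝ) ≤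
      b * (Finset.univ.filter A).card := by
    rw [← Nat.cast_sub hcard, ← Nat.cast_mul, h, Nat.cast_sum, mul_comm, ← nsmul_eq_mul]
    refine Finset.sum_le_card_nsmul _ _ _ fun σ hσ => ?_
    refine le_trans ?_ (hb σ (Finset.mem_filter.1 hσ).2)
    exact_mod_cast Finset.card_le_card Finset.sdiff_subset
  rw [pr_eq (fun σ => A σ ∧ σ r ∈ B σ), pr_eq A, ← mul_div_assoc]
  gcongr
  rw [div_mul_eq_mul_div, le_div_iff₀ (by linarith), mul_comm]
  refine le_trans ?_ h2
  exact mul_le_mul_of_nonneg_right (sub_le_sub_left hQ _) (Nat.cast_nonneg _)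

lemma pr_apply_notMem_le {Q : Finset ι} {r : ι} (hr : r ∉ Q) {A : (ι ≃ α) → Prop}
    {B : (ι ≃ α) → Finset α} (hA : DeterminedOn Q A) (hB : DeterminedOn Q B) {b : ℝ}
    (hb : ∀ σ, A σ → b ≤ ((B σ \ Q.image σ).card : ℝ)) :
    pr (fun σ => A σ ∧ σ r ∉ B σ) ≤ (1 - b / Fintype.card ι) * pr A := by
  classical
  have h := card_filter_apply_mem hr hA hB
  have hcard : Q.card ≤ Fintype.card ι := Finset.card_le_univ Q
  have hpos : 0 < Fintype.card ι := Fintype.card_pos_iff.2 ⟨r⟩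
  have h2 : b * (Finset.univ.filter A).card ≤ (Fintype.card ι : ℝ) *
      ((Finset.univ.filter fun σ => A σ ∧ σ r ∈ B σ).card : ℝ) := by
    calc b * (Finset.univ.filter A).card ≤ ((Fintype.card ι - Q.card : ℕ) : ℝ) *
        ((Finset.univ.filter fun σ => A σ ∧ σ r ∈ B σ).card : ℝ) := by
          rw [← Nat.cast_mul, h, Nat.cast_sum, mul_comm, ← nsmul_eq_mul]
          exact Finset.card_nsmul_le_sum _ _ _ fun σ hσ => hb σ (Finset.mem_filter.1 hσ).2
      _ ≤ _ := by
          gcongr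
          exact Nat.sub_le _ _
  have h3 : ((Finset.univ.filter fun σ => A σ ∧ σ r ∈ B σ).card : ℝ) +
      (Finset.univ.filter fun σ => A σ ∧ σ r ∉ B σ).card = (Finset.univ.filter A).card := by
    have := Finset.card_filter_add_card_filter_not (s := Finset.univ.filter A) (fun σ => σ r ∈ B σ)
    rw [Finset.filter_filter, Finset.filter_filter] at this
    exact_mod_cast this
  rw [pr_eq, pr_eq, ← mul_div_assoc]
  gcongr
  rw [sub_mul, one_mul, div_mul_eq_mul_div, ← h3, le_sub_iff_add_le, add_comm, h3, ← h3]
  gcongr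
  rw [div_le_iff₀ (by positivity), h3]
  linarith

lemma DeterminedOn.mono {ι α β : Type*} {Q Q' : Finset ι} {f : (ι ≃ α) → β} (h : DeterminedOn Q f)
    (hQ : Q ⊆ Q') : DeterminedOn Q' f := fun σ σ' hσ => h σ σ' fun q hq => hσ q (hQ hq)

lemma DeterminedOn.and {ι α : Type*} {Q : Finset ι} {A A' : (ι ≃ α) → Prop} (h : DeterminedOn Q A)
    (h' : DeterminedOn Q A') : DeterminedOn Q fun σ => A σ ∧ A' σ := fun σ σ' hσ => by
  simp only [h σ σ' hσ, h' σ σ' hσ]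

lemma determinedOn_of_forall {ι α : Type*} {Q : Finset ι} (P : ι → α → Prop) :
    DeterminedOn Q fun σ : ι ≃ α => ∀ q ∈ Q, P q (σ q) := fun σ σ' hσ =>
  propext (forall₂_congr fun q hq => by rw [hσ q hq])

/-- The values on `R` all avoid the set `B σ`, determined by the values on `Q`. -/
lemma pr_forall_notMem_le {Q R : Finset ι} (hQR : Disjoint Q R) {A : (ι ≃ α) → Prop}
    {B : (ι ≃ α) → Finset α} (hA : DeterminedOn Q A) (hB : DeterminedOn Q B) {b : ℝ}
    (hb : ∀ σ, A σ → b ≤ ((B σ \ Q.image σ).card : ℝ)) :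
    pr (fun σ => A σ ∧ ∀ r ∈ R, σ r ∉ B σ) ≤ (1 - b / Fintype.card ι) ^ R.card * pr A := by
  classical
  induction R using Finset.induction_on with
  | empty => simp
  | insert r R hr ih =>
    rw [Finset.disjoint_insert_right] at hQR
    have hdet : DeterminedOn (Q ∪ R) fun σ : ι ≃ α => A σ ∧ ∀ r ∈ R, σ r ∉ B σ := by
      intro σ σ' hσ
      have h1 := hA σ σ' fun q hq => hσ q (Finset.mem_union_left _ hq)
      have h2 := hB σ σ' fun q hq => hσ q (Finset.mem_union_left _ hq)
      simp only
      rw [h1, h2]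
      refine propext (and_congr_right fun _ => forall₂_congr fun q hq => ?_)
      rw [hσ q (Finset.mem_union_right _ hq)]
    have h1 := pr_apply_notMem_le (r := r) (by simp [hr, hQR.1]) hdet
      (hB.mono Finset.subset_union_left) (b := b) (by
        rintro σ ⟨hσ, hR⟩
        refine (hb σ hσ).trans ?_
        have : B σ \ (Q ∪ R).image σ = B σ \ Q.image σ := by
          ext c
          simp only [Finset.mem_sdiff, Finset.mem_image, Finset.mem_union]
          constructor
          · rintro ⟨h, h'⟩
            exact ⟨h, fun ⟨q, hq, e⟩ => h' ⟨q, Or.inl hq, e⟩⟩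
          · rintro ⟨h, h'⟩
            refine ⟨h, ?_⟩
            rintro ⟨q, hq | hq, rfl⟩
            · exact h' ⟨q, hq, rfl⟩
            · exact hR q hq h
        rw [this])
    have hpos : 0 < Fintype.card ι := Fintype.card_pos_iff.2 ⟨r⟩
    by_cases hA0 : ∃ σ, A σ
    · obtain ⟨σ, hσ⟩ := hA0
      have hb1 : 0 ≤ 1 - b / Fintype.card ι := by
        rw [sub_nonneg]
        refine div_le_one_of_le₀ ((hb σ hσ).trans ?_) (by positivity)
        rw [Fintype.card_congr σ]
        exact_mod_cast Finset.card_le_univ _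
      calc _ = pr (fun σ => (A σ ∧ ∀ r ∈ R, σ r ∉ B σ) ∧ σ r ∉ B σ) := by
            refine pr_congr fun σ => ?_
            rw [Finset.forall_mem_insert]; tauto
        _ ≤ _ := h1
        _ ≤ (1 - b / Fintype.card ι) * ((1 - b / Fintype.card ι) ^ R.card * pr A) := by
            gcongr
            exact ih hQR.2
        _ = _ := by rw [Finset.card_insert_of_notMem hr]; ring
    · push Not at hA0
      have : pr A = 0 := by rw [pr_eq]; simp [hA0]
      rw [this, mul_zero]
      refine (pr_mono fun σ h => h.1).trans this.le

lemma pr_forall_mem_le {Q R : Finset ι} (hQR : Disjoint Q R) {A : (ι ≃ α) → Prop}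
    (hA : DeterminedOn Q A) (F : Finset α) {b q : ℝ}
    (hb : (F.card : ℝ) ≤ b) (hQ : (Q.card : ℝ) + R.card ≤ q) (hq : q < Fintype.card ι) :
    pr (fun σ => A σ ∧ ∀ r ∈ R, σ r ∈ F) ≤ (b / (Fintype.card ι - q)) ^ R.card * pr A := by
  classical
  have hb0 : 0 ≤ b := le_trans (by positivity) hb
  induction R using Finset.induction_on with
  | empty => simp
  | insert r R hr ih =>
    rw [Finset.disjoint_insert_right] at hQR
    rw [Finset.card_insert_of_notMem hr] at hQ
    push_cast at hQ
    have hdet : DeterminedOn (Q ∪ R) fun σ : ι ≃ α => A σ ∧ ∀ r ∈ R, σ r ∈ F :=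
      (hA.mono Finset.subset_union_left).and
        ((determinedOn_of_forall (fun _ c => c ∈ F)).mono Finset.subset_union_right)
    have h1 := pr_apply_mem_le (r := r) (by simp [hr, hQR.1]) hdet (B := fun _ => F)
      (fun _ _ _ => rfl) (b := b) (q := q) (fun _ _ => hb) (by
        have : (Q ∪ R).card ≤ Q.card + R.card := Finset.card_union_le _ _
        have : ((Q ∪ R).card : ℝ) ≤ Q.card + R.card := by exact_mod_cast this
        linarith) hq
    have : 0 < (Fintype.card ι : ℝ) - q := by linarith
    calc _ = pr (fun σ => (A σ ∧ ∀ r ∈ R, σ r ∈ F) ∧ σ r ∈ F) := by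
            refine pr_congr fun σ => ?_
            rw [Finset.forall_mem_insert]; tauto
      _ ≤ _ := h1
      _ ≤ b / (Fintype.card ι - q) * ((b / (Fintype.card ι - q)) ^ R.card * pr A) := by
          gcongr
          exact ih hQR.2 (by linarith)
      _ = _ := by rw [Finset.card_insert_of_notMem hr]; ring

end Bijections

section Copies
variable {k n : ℕ} {H : SimpleGraph (Fin k)}

noncomputable instance : Fintype (Copy H n) := Fintype.ofFinite _

noncomputable instance : DecidableEq (Copy H n) := Classical.decEq _

lemma numCopies_eq : numCopies H n = Fintype.card (Copy H n) := Nat.card_eq_fintype_card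

open Classical in
/-- The vertices of a copy. -/
noncomputable def verts (c : Copy H n) : Finset (Fin n) :=
  Finset.univ.filter fun v => ∃ w, c.1.Adj v w

lemma mem_verts {c : Copy H n} {v : Fin n} : v ∈ verts c ↔ ∃ w, c.1.Adj v w := by simp [verts]

lemma mem_verts_left {c : Copy H n} {v w : Fin n} (h : c.1.Adj v w) : v ∈ verts c :=
  mem_verts.2 ⟨w, h⟩

lemma mem_verts_right {c : Copy H n} {v w : Fin n} (h : c.1.Adj v w) : w ∈ verts c :=
  mem_verts.2 ⟨v, h.symm⟩

lemma card_verts (hiso : ∀ v, (H.neighborSet v).Nonempty) (c : Copy H n) : (verts c).card = k := by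
  obtain ⟨G, f, rfl⟩ := c
  have : verts ⟨H.map f, f, rfl⟩ = Finset.univ.map f := by
    ext v
    rw [mem_verts]
    simp only [SimpleGraph.map_adj, Finset.mem_map, Finset.mem_univ, true_and]
    constructor
    · rintro ⟨w, a, b, -, ha, -⟩
      exact ⟨a, ha⟩
    · rintro ⟨a, rfl⟩
      obtain ⟨b, hb⟩ := hiso a
      exact ⟨f b, a, b, hb, rfl, rfl⟩
  rw [this, Finset.card_map, Finset.card_univ, Fintype.card_fin]

open Classical in
/-- The number of ordered pairs of adjacent vertices. -/
noncomputable def arcCount {V : Type*} [Fintype V] (G : SimpleGraph V) : ℕ :=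
  (Finset.univ.filter fun e : V × V => G.Adj e.1 e.2).card

lemma arcCount_copy (c : Copy H n) : arcCount c.1 = arcCount H := by
  classical
  obtain ⟨G, f, rfl⟩ := c
  symm
  refine Finset.card_bij (fun e _ => (f e.1, f e.2)) ?_ ?_ ?_
  · intro e he
    simpa using he
  · rintro ⟨a, b⟩ _ ⟨a', b'⟩ _ h
    simpa using h
  · rintro ⟨a, b⟩ h
    simp only [Finset.mem_filter, Finset.mem_univ, true_and, SimpleGraph.map_adj] at h
    obtain ⟨x, y, hxy, hx, hy⟩ := h
    exact ⟨(x, y), by simpa using hxy, by simp [hx, hy]⟩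

lemma arcCount_pos (hk : 0 < k) (hiso : ∀ v, (H.neighborSet v).Nonempty) : 0 < arcCount H := by
  classical
  obtain ⟨w, hw⟩ := hiso ⟨0, hk⟩
  exact Finset.card_pos.2 ⟨(⟨0, hk⟩, w), by simpa using hw⟩

lemma arcCount_le : arcCount H ≤ k ^ 2 := by
  classical
  refine (Finset.card_filter_le _ _).trans ?_
  simp [sq]

/-- The action of permutations of the vertices on copies. -/
def permCopy (π : Equiv.Perm (Fin n)) (c : Copy H n) : Copy H n :=
  ⟨c.1.map π.toEmbedding, by
    obtain ⟨f, hf⟩ := c.2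
    exact ⟨f.trans π.toEmbedding, by rw [hf, SimpleGraph.map_map]; rfl⟩⟩

lemma permCopy_adj {π : Equiv.Perm (Fin n)} {c : Copy H n} {x y : Fin n} (h : c.1.Adj x y) :
    (permCopy π c).1.Adj (π x) (π y) :=
  ⟨fun e => h.ne (π.injective e), x, y, h, rfl, rfl⟩

lemma permCopy_verts {π : Equiv.Perm (Fin n)} {c : Copy H n} {x : Fin n} (h : x ∈ verts c) :
    π x ∈ verts (permCopy π c) := by
  obtain ⟨w, hw⟩ := mem_verts.1 h
  exact mem_verts_left (permCopy_adj hw)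

lemma permCopy_injective (π : Equiv.Perm (Fin n)) :
    Function.Injective (permCopy π : Copy H n → Copy H n) := fun _ _ h =>
  Subtype.ext (SimpleGraph.map_injective π.toEmbedding (congrArg Subtype.val h))

open Classical in
/-- Double counting for a relation between copies and pairs of vertices that is invariant under
permutations. -/
lemma pair_count {R : Copy H n → Fin n → Fin n → Prop}
    (hR : ∀ π c x y, R c x y → R (permCopy π c) (π x) (π y)) {s : ℕ}
    (hs : ∀ c, ((Finset.univ : Finset (Fin n)).offDiag.filter fun e => R c e.1 e.2).card = s)
    {x y : Fin n} (hxy : x ≠ y) :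
    n * (n - 1) * (Finset.univ.filter fun c => R c x y).card = s * numCopies H n := by
  have hle : ∀ x y x' y' : Fin n, x ≠ y → x' ≠ y' →
      (Finset.univ.filter fun c => R c x y).card ≤ (Finset.univ.filter fun c => R c x' y').card := by
    intro x y x' y' h h'
    obtain ⟨π, hx, hy⟩ : ∃ π : Equiv.Perm (Fin n), π x = x' ∧ π y = y' := by
      refine ⟨(Equiv.swap x x').trans (Equiv.swap (Equiv.swap x x' y) y'), ?_, ?_⟩
      · rw [Equiv.trans_apply, Equiv.swap_apply_left]
        refine Equiv.swap_apply_of_ne_of_ne ?_ h'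
        intro e
        exact h ((Equiv.swap x x').injective (by rw [Equiv.swap_apply_left]; exact e))
      · rw [Equiv.trans_apply, Equiv.swap_apply_left]
    refine Finset.card_le_card_of_injOn (permCopy π) ?_ (permCopy_injective π).injOn
    intro c hc
    have := hR π c x y (by simpa using hc)
    rw [hx, hy] at this
    simpa using this
  have h1 : ∑ e ∈ (Finset.univ : Finset (Fin n)).offDiag,
      (Finset.univ.filter fun c => R c e.1 e.2).card = s * numCopies H n := by
    have := Finset.sum_card_bipartiteAbove_eq_sum_card_bipartiteBelow
      (s := (Finset.univ : Finset (Fin n)).offDiag) (t := (Finset.univ : Finset (Copy H n)))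
      (fun e c => R c e.1 e.2)
    simp only [Finset.bipartiteAbove, Finset.bipartiteBelow, hs] at this
    rw [this, Finset.sum_const, Finset.card_univ, numCopies_eq, smul_eq_mul, mul_comm]
  rw [← h1, Finset.sum_const_nat (m := (Finset.univ.filter fun c => R c x y).card),
    Finset.offDiag_card, Finset.card_univ, Fintype.card_fin, Nat.mul_sub_one]
  rintro ⟨a, b⟩ h
  have hab : a ≠ b := by simpa using h
  exact le_antisymm (hle _ _ _ _ hab hxy) (hle _ _ _ _ hxy hab)

open Classical in
lemma card_copies_mem (hiso : ∀ v, (H.neighborSet v).Nonempty) (v : Fin n) :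
    n * (Finset.univ.filter fun c : Copy H n => v ∈ verts c).card = k * numCopies H n := by
  have hle : ∀ x x' : Fin n, (Finset.univ.filter fun c : Copy H n => x ∈ verts c).card ≤
      (Finset.univ.filter fun c : Copy H n => x' ∈ verts c).card := by
    intro x x'
    refine Finset.card_le_card_of_injOn (permCopy (Equiv.swap x x')) ?_
      (permCopy_injective _).injOn
    intro c hc
    have := permCopy_verts (π := Equiv.swap x x') (c := c) (x := x) (by simpa using hc)
    rw [Equiv.swap_apply_left] at this
    simpa using this
  have h1 := Finset.sum_card_bipartiteAbove_eq_sum_card_bipartiteBelow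
      (s := (Finset.univ : Finset (Fin n))) (t := (Finset.univ : Finset (Copy H n)))
      (fun e c => e ∈ verts c)
  simp only [Finset.bipartiteAbove, Finset.bipartiteBelow] at h1
  rw [Finset.sum_const_nat (m := (Finset.univ.filter fun c : Copy H n => v ∈ verts c).card)
    (fun x _ => le_antisymm (hle _ _) (hle _ _)), Finset.card_univ, Fintype.card_fin,
    Finset.sum_const_nat (m := k), Finset.card_univ, ← numCopies_eq] at h1
  · rw [h1, mul_comm]
  · intro c _
    refine Eq.trans ?_ (card_verts hiso c)
    congr 1
    ext; simp

open Classical in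
lemma card_copies_mem_mem (hiso : ∀ v, (H.neighborSet v).Nonempty) {u v : Fin n} (huv : u ≠ v) :
    n * (n - 1) * (Finset.univ.filter fun c : Copy H n => u ∈ verts c ∧ v ∈ verts c).card =
      k * (k - 1) * numCopies H n := by
  convert pair_count (H := H) (s := k * (k - 1)) (R := fun c x y => x ∈ verts c ∧ y ∈ verts c)
    (fun π c x y h => ⟨permCopy_verts h.1, permCopy_verts h.2⟩) (fun c => ?_) huv
  refine Eq.trans (b := (verts c).offDiag.card) ?_
    (by rw [Finset.offDiag_card, card_verts hiso c, Nat.mul_sub_one])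
  congr 1
  ext ⟨a, b⟩
  simp only [Finset.mem_filter, Finset.mem_offDiag, Finset.mem_univ, true_and]
  tauto

open Classical in
lemma card_copies_adj {u v : Fin n} (huv : u ≠ v) :
    n * (n - 1) * (Finset.univ.filter fun c : Copy H n => c.1.Adj u v).card =
      arcCount H * numCopies H n := by
  refine pair_count (R := fun c x y => c.1.Adj x y)
    (fun π c x y h => permCopy_adj h) (fun c => ?_) huv
  rw [← arcCount_copy c, arcCount]
  congr 1
  ext ⟨a, b⟩
  simp only [Finset.mem_filter, Finset.mem_offDiag, Finset.mem_univ, true_and, and_iff_right_iff_imp]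
  exact fun h => h.ne

lemma numCopies_pos (hkn : k ≤ n) : 0 < numCopies H n := by
  rw [numCopies_eq, Fintype.card_pos_iff]
  exact ⟨⟨_, Fin.castLEEmb hkn, rfl⟩⟩

lemma le_numCopies (hk : 0 < k) (hiso : ∀ v, (H.neighborSet v).Nonempty) (hkn : k ≤ n) :
    n * (n - 1) ≤ k ^ 2 * numCopies H n := by
  classical
  rcases lt_or_ge n 2 with hn | hn
  · have : n - 1 = 0 := by omega
    simp [this]
  have h := card_copies_adj (H := H) (u := (⟨0, by omega⟩ : Fin n)) (v := ⟨1, by omega⟩) (by simp)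
  have hpos : 0 < arcCount H * numCopies H n :=
    Nat.mul_pos (arcCount_pos hk hiso) (numCopies_pos hkn)
  rw [← h] at hpos
  calc n * (n - 1) ≤ _ := Nat.le_mul_of_pos_right _ (Nat.pos_of_mul_pos_left hpos)
    _ = _ := h
    _ ≤ _ := Nat.mul_le_mul_right _ arcCount_le

open Classical in
/-- A set of `m` ordered pairs of distinct vertices is hit by at least a proportion
`m / (n (n - 1))` of the copies. -/
lemma card_copies_hit (hk : 0 < k) (hiso : ∀ v, (H.neighborSet v).Nonempty)
    (E : Finset (Fin n × Fin n)) (hE : ∀ e ∈ E, e.1 ≠ e.2) :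
    E.card * numCopies H n ≤
      n * (n - 1) * (Finset.univ.filter fun c : Copy H n => ∃ e ∈ E, c.1.Adj e.1 e.2).card := by
  set hit := Finset.univ.filter fun c : Copy H n => ∃ e ∈ E, c.1.Adj e.1 e.2
  have h1 := Finset.sum_card_bipartiteAbove_eq_sum_card_bipartiteBelow
      (s := E) (t := (Finset.univ : Finset (Copy H n))) (fun e c => c.1.Adj e.1 e.2)
  simp only [Finset.bipartiteAbove, Finset.bipartiteBelow] at h1
  have h2 : ∑ c : Copy H n, (E.filter fun e => c.1.Adj e.1 e.2).card ≤ hit.card * arcCount H := by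
    rw [← Finset.sum_subset (Finset.subset_univ hit), ← smul_eq_mul]
    · refine Finset.sum_le_card_nsmul _ _ _ fun c _ => ?_
      rw [← arcCount_copy c]
      refine Finset.card_le_card fun e he => ?_
      simpa using (Finset.mem_filter.1 he).2
    · intro c _ hc
      rw [Finset.card_eq_zero, Finset.filter_eq_empty_iff]
      intro e he h
      exact hc (by simpa [hit] using ⟨e.1, e.2, he, h⟩)
  rw [← h1] at h2
  refine Nat.le_of_mul_le_mul_left ?_ (arcCount_pos hk hiso)
  calc arcCount H * (E.card * numCopies H n) = E.card * (arcCount H * numCopies H n) := by ring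
    _ = ∑ e ∈ E, n * (n - 1) * (Finset.univ.filter fun c : Copy H n => c.1.Adj e.1 e.2).card := by
        rw [Finset.sum_congr rfl fun e he => card_copies_adj (hE e he), Finset.sum_const,
          smul_eq_mul]
    _ ≤ n * (n - 1) * (hit.card * arcCount H) := by
        rw [← Finset.mul_sum]
        exact Nat.mul_le_mul_left _ h2
    _ = _ := by ring

end Copies

section Structure
variable {k n : ℕ} {H : SimpleGraph (Fin k)}

/-- The union of the copies at the positions in `T`. -/
def unionGraph (ω : ProcSample H n) (T : Finset (Fin (numCopies H n))) : SimpleGraph (Fin n) where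
  Adj x y := ∃ p ∈ T, (ω p).1.Adj x y
  symm := ⟨fun _ _ ⟨p, hp, h⟩ => ⟨p, hp, h.symm⟩⟩
  loopless := ⟨fun _ ⟨_, _, h⟩ => h.ne rfl⟩

lemma unionGraph_adj {ω : ProcSample H n} {T : Finset (Fin (numCopies H n))} {x y : Fin n} :
    (unionGraph ω T).Adj x y ↔ ∃ p ∈ T, (ω p).1.Adj x y := Iff.rfl

lemma unionGraph_mono (ω : ProcSample H n) {T T' : Finset (Fin (numCopies H n))} (h : T ⊆ T') :
    unionGraph ω T ≤ unionGraph ω T' := fun _ _ ⟨p, hp, hxy⟩ => ⟨p, h hp, hxy⟩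

/-- The first `m` positions. -/
def firstPos (N m : ℕ) : Finset (Fin N) := Finset.univ.filter fun j => (j : ℕ) < m

lemma mem_firstPos {N m : ℕ} {j : Fin N} : j ∈ firstPos N m ↔ (j : ℕ) < m := by simp [firstPos]

lemma firstPos_mono {N m m' : ℕ} (h : m ≤ m') : firstPos N m ⊆ firstPos N m' := fun _ hj =>
  mem_firstPos.2 ((mem_firstPos.1 hj).trans_le h)

lemma card_firstPos_le (N m : ℕ) : (firstPos N m).card ≤ m := by
  have : (firstPos N m).map Fin.valEmbedding ⊆ Finset.range m := by
    intro x hx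
    simp only [Finset.mem_map, mem_firstPos] at hx
    obtain ⟨a, ha, rfl⟩ := hx
    simpa using ha
  simpa using Finset.card_le_card this

lemma card_firstPos {N m : ℕ} (h : m ≤ N) : (firstPos N m).card = m := by
  refine le_antisymm (card_firstPos_le N m) ?_
  have : Finset.range m ⊆ (firstPos N m).map Fin.valEmbedding := by
    intro x hx
    simp only [Finset.mem_map, mem_firstPos]
    exact ⟨⟨x, (Finset.mem_range.1 hx).trans_le h⟩, Finset.mem_range.1 hx, rfl⟩
  simpa using Finset.card_le_card this

lemma procGraph_eq (ω : ProcSample H n) (i : ℕ) :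
    procGraph ω i = unionGraph ω (firstPos _ i) := by
  ext x y
  rw [procGraph, SimpleGraph.iSup_adj, unionGraph_adj]
  refine exists_congr fun j => ?_
  rw [mem_firstPos]
  split_ifs with h <;> simp [h]

/-- `u` and `v` are joined by a chain of copies at the positions of the list. -/
def Chain (ω : ProcSample H n) : Fin n → List (Fin (numCopies H n)) → Fin n → Prop
  | u, [], v => u = v
  | u, p :: ps, v => ∃ x, x ≠ u ∧ u ∈ verts (ω p) ∧ x ∈ verts (ω p) ∧ Chain ω x ps v

lemma Chain.exists_of_append {ω : ProcSample H n} {a b : List (Fin (numCopies H n))}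
    {u v : Fin n} (h : Chain ω u (a ++ b) v) : ∃ z, Chain ω z b v := by
  induction a generalizing u with
  | nil => exact ⟨u, h⟩
  | cons p a ih =>
    obtain ⟨x, -, -, -, h⟩ := h
    exact ih h

lemma exists_chain_of_walk {ω : ProcSample H n} {T : Finset (Fin (numCopies H n))} {u v : Fin n}
    (w : (unionGraph ω T).Walk u v) :
    ∃ ps : List (Fin (numCopies H n)), ps.Nodup ∧ (∀ p ∈ ps, p ∈ T) ∧ ps.length ≤ w.length ∧
      Chain ω u ps v := by
  induction w with
  | nil => exact ⟨[], by simp, by simp, by simp, rfl⟩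
  | @cons u x v hux w ih =>
    obtain ⟨ps, hnd, hT, hlen, hc⟩ := ih
    rw [SimpleGraph.Walk.length_cons]
    obtain ⟨p, hp, hadj⟩ := hux
    by_cases hpps : p ∈ ps
    · obtain ⟨a, b, rfl⟩ := List.append_of_mem hpps
      obtain ⟨z, hz⟩ := hc.exists_of_append
      obtain ⟨y, -, -, hy, hyb⟩ := hz
      have hsub : (p :: b).Sublist (a ++ p :: b) := List.sublist_append_right _ _
      by_cases hyu : y = u
      · subst hyu
        have hsub' := (List.sublist_cons_self p b).trans hsub
        exact ⟨b, hnd.sublist hsub', fun q hq => hT q (hsub'.subset hq),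
          hsub'.length_le.trans (by omega), hyb⟩
      · exact ⟨p :: b, hnd.sublist hsub, fun q hq => hT q (hsub.subset hq),
          hsub.length_le.trans (by omega), y, hyu, mem_verts_left hadj, hy, hyb⟩
    · refine ⟨p :: ps, List.nodup_cons.2 ⟨hpps, hnd⟩, ?_, by simpa using hlen, x, hadj.ne.symm,
        mem_verts_left hadj, mem_verts_right hadj, hc⟩
      simpa using ⟨hp, hT⟩

/-- Expansion of small sets in a union of copies in which the exceptional vertices `S` are far
apart, all other vertices are covered often, and small sets are sparse. -/
lemma expands_of_sparse {ω : ProcSample H n} (hk : 0 < k)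
    (hiso : ∀ v, (H.neighborSet v).Nonempty) {T : Finset (Fin (numCopies H n))} {a : ℕ}
    {S : Finset (Fin n)}
    (hlarge : ∀ U : Finset (Fin n), a < U.card → 4 * U.card ≤ n →
      2 * U.card ≤ (nbrs (unionGraph ω T) U \ U).card)
    (hdeg : ∀ v, 2 ≤ (nbrs (unionGraph ω T) {v}).card)
    (hfar : ∀ u ∈ S, ∀ v ∈ S, u ≠ v → ∀ w : (unionGraph ω T).Walk u v, 4 < w.length)
    (hcov : ∀ v ∉ S, 12 * k ≤ (T.filter fun p => v ∈ verts (ω p)).card)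
    (hsparse : ∀ W : Finset (Fin n), W.Nonempty → W.card ≤ 6 * a →
      (T.filter fun p => 2 ≤ (verts (ω p) ∩ W).card).card < 2 * W.card) :
    Expands (unionGraph ω T) := by
  classical
  intro U hU
  rw [Fintype.card_fin] at hU
  rcases lt_or_ge a U.card with ha | ha
  · exact hlarge U ha hU
  set Γ := unionGraph ω T with hΓ
  set U₂ := U.filter (· ∉ S) with hU₂
  set V₁ := U.filter fun v => v ∈ S ∧ ∃ z ∈ U₂, ∃ w : Γ.Walk v z, w.length ≤ 2 with hV₁
  set V₂ := U.filter fun v => v ∈ S ∧ ¬ ∃ z ∈ U₂, ∃ w : Γ.Walk v z, w.length ≤ 2 with hV₂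
  set U' := V₁ ∪ U₂ with hU'
  have hUU : U = U' ∪ V₂ := by
    ext v
    have e : v ∈ U₂ ↔ v ∈ U ∧ v ∉ S := Finset.mem_filter
    simp only [hU', hV₁, hV₂, Finset.mem_union, Finset.mem_filter, e]
    by_cases h : ∃ z ∈ U₂, ∃ w : Γ.Walk v z, w.length ≤ 2 <;> simp only [h] <;> tauto
  have hcardV₁ : V₁.card ≤ U₂.card := by
    have hz : ∀ v ∈ V₁, ∃ z ∈ U₂, ∃ w : Γ.Walk v z, w.length ≤ 2 := fun v hv =>
      (Finset.mem_filter.1 hv).2.2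
    choose! f hf hw using hz
    refine Finset.card_le_card_of_injOn f hf ?_
    intro x hx y hy hxy
    by_contra hne
    obtain ⟨w₁, h₁⟩ := hw x hx
    obtain ⟨w₂, h₂⟩ := hw y hy
    have := hfar x (Finset.mem_filter.1 hx).2.1 y (Finset.mem_filter.1 hy).2.1 hne
      (w₁.append (w₂.reverse.copy hxy.symm rfl))
    rw [SimpleGraph.Walk.length_append, SimpleGraph.Walk.length_copy,
      SimpleGraph.Walk.length_reverse] at this
    omega
  have hcardU' : U'.card ≤ 2 * U₂.card := (Finset.card_union_le _ _).trans (by omega)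
  have hfar1 : ∀ u ∈ S, ∀ v ∈ S, ¬ Γ.Adj u v := fun u hu v hv h => by
    have := hfar u hu v hv h.ne (.cons h .nil)
    simp at this
  have hfar2 : ∀ u ∈ S, ∀ v ∈ S, u ≠ v → ∀ y, Γ.Adj u y → ¬ Γ.Adj v y :=
    fun u hu v hv hne y h h' => by
      have := hfar u hu v hv hne (.cons h (.cons h'.symm .nil))
      simp at this
  have hV₂S : ∀ v ∈ V₂, v ∈ S := fun v hv => (Finset.mem_filter.1 hv).2.1
  have hV₂1 : ∀ v ∈ V₂, ∀ z ∈ U₂, ¬ Γ.Adj v z := fun v hv z hz h =>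
    (Finset.mem_filter.1 hv).2.2 ⟨z, hz, .cons h .nil, by simp⟩
  have hV₂2 : ∀ v ∈ V₂, ∀ z ∈ U₂, ∀ y, Γ.Adj v y → ¬ Γ.Adj z y := fun v hv z hz y h h' =>
    (Finset.mem_filter.1 hv).2.2 ⟨z, hz, .cons h (.cons h'.symm .nil), by simp⟩
  have hV₁S : ∀ v ∈ V₁, v ∈ S := fun v hv => (Finset.mem_filter.1 hv).2.1
  have hV₁₂ : ∀ u ∈ V₁, ∀ v ∈ V₂, u ≠ v := fun u hu v hv h => by
    subst h
    exact (Finset.mem_filter.1 hv).2.2 (Finset.mem_filter.1 hu).2.2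
  have hUsub : U ⊆ U' ∪ V₂ := hUU.le
  have hV₂card : 2 * V₂.card ≤ (nbrs Γ V₂).card := by
    have : nbrs Γ V₂ = V₂.biUnion fun v => nbrs Γ {v} := by
      ext y
      simp [mem_nbrs]
    rw [this, Finset.card_biUnion, mul_comm, ← smul_eq_mul]
    · exact Finset.card_nsmul_le_sum _ _ _ fun v _ => hdeg v
    · intro x hx y hy hne
      refine Finset.disjoint_left.2 fun z hz hz' => ?_
      simp only [mem_nbrs, Finset.mem_singleton, exists_eq_left] at hz hz'
      exact hfar2 x (hV₂S x hx) y (hV₂S y hy) hne z hz hz'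
  have hdisj : Disjoint (nbrs Γ V₂) (nbrs Γ U' \ U') := by
    refine Finset.disjoint_left.2 fun y hy hy' => ?_
    obtain ⟨v, hv, hvy⟩ := mem_nbrs.1 hy
    obtain ⟨u, hu, huy⟩ := mem_nbrs.1 (Finset.mem_sdiff.1 hy').1
    rcases Finset.mem_union.1 hu with hu | hu
    · exact hfar2 u (hV₁S u hu) v (hV₂S v hv) (hV₁₂ u hu v hv) y huy hvy
    · exact hV₂2 v hv u hu y hvy huy
  have hsub : nbrs Γ V₂ ∪ (nbrs Γ U' \ U') ⊆ nbrs Γ U \ U := by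
    intro y hy
    rw [Finset.mem_sdiff, mem_nbrs]
    rcases Finset.mem_union.1 hy with hy | hy
    · obtain ⟨v, hv, hvy⟩ := mem_nbrs.1 hy
      refine ⟨⟨v, (Finset.mem_filter.1 hv).1, hvy⟩, fun hyU => ?_⟩
      by_cases hyS : y ∈ S
      · exact hfar1 v (hV₂S v hv) y hyS hvy
      · exact hV₂1 v hv y (Finset.mem_filter.2 ⟨hyU, hyS⟩) hvy
    · obtain ⟨hy, hyU'⟩ := Finset.mem_sdiff.1 hy
      obtain ⟨u, hu, huy⟩ := mem_nbrs.1 hy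
      refine ⟨⟨u, by rw [hUU]; exact Finset.mem_union_left _ hu, huy⟩, fun hyU => ?_⟩
      rcases Finset.mem_union.1 (hUsub hyU) with h | h
      · exact hyU' h
      · rcases Finset.mem_union.1 hu with hu | hu
        · exact hfar1 u (hV₁S u hu) y (hV₂S y h) huy
        · exact hV₂1 y h u hu huy.symm
  have hU'card : 2 * U'.card ≤ (nbrs Γ U' \ U').card := by
    by_contra! hlt
    set W := U' ∪ (nbrs Γ U' \ U') with hW
    have hWc : W.card < 3 * U'.card := (Finset.card_union_le _ _).trans_lt (by omega)
    have hU₂U : U₂.card ≤ U.card := Finset.card_filter_le _ _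
    have hWne : W.Nonempty := by
      rw [Finset.nonempty_iff_ne_empty]
      rintro h
      have : U'.card = 0 := by
        rw [Finset.card_eq_zero, ← Finset.subset_empty, ← h]
        exact Finset.subset_union_left
      omega
    have hsp := hsparse W hWne (by omega)
    have hdc := Finset.sum_card_bipartiteAbove_eq_sum_card_bipartiteBelow
      (s := U₂) (t := T) (fun v p => v ∈ verts (ω p))
    simp only [Finset.bipartiteAbove, Finset.bipartiteBelow] at hdc
    have h1 : U₂.card * (12 * k) ≤ ∑ v ∈ U₂, (T.filter fun p => v ∈ verts (ω p)).card := by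
      rw [← smul_eq_mul]
      exact Finset.card_nsmul_le_sum _ _ _ fun v hv => hcov v (Finset.mem_filter.1 hv).2
    have h2 : ∑ p ∈ T, (U₂.filter fun v => v ∈ verts (ω p)).card ≤
        (T.filter fun p => 2 ≤ (verts (ω p) ∩ W).card).card * k := by
      rw [← Finset.sum_subset (Finset.filter_subset (fun p => 2 ≤ (verts (ω p) ∩ W).card) T),
        ← smul_eq_mul]
      · refine Finset.sum_le_card_nsmul _ _ _ fun p _ => ?_
        refine (Finset.card_le_card fun v hv => ?_).trans (card_verts hiso (ω p)).le
        exact (Finset.mem_filter.1 hv).2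
      · intro p hp hp'
        rw [Finset.card_eq_zero, Finset.filter_eq_empty_iff]
        intro u hu hup
        refine hp' (Finset.mem_filter.2 ⟨hp, ?_⟩)
        obtain ⟨x, hx⟩ := mem_verts.1 hup
        have huU' : u ∈ U' := Finset.mem_union_right _ hu
        rw [← Finset.card_pair hx.ne]
        refine Finset.card_le_card fun y hy => ?_
        rw [Finset.mem_inter]
        rcases Finset.mem_insert.1 hy with rfl | hy
        · exact ⟨hup, Finset.mem_union_left _ huU'⟩
        · rw [Finset.mem_singleton.1 hy]
          refine ⟨mem_verts_right hx, ?_⟩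
          by_cases hxU : x ∈ U'
          · exact Finset.mem_union_left _ hxU
          · exact Finset.mem_union_right _
              (Finset.mem_sdiff.2 ⟨mem_nbrs.2 ⟨u, huU', p, hp, hx⟩, hxU⟩)
    rw [← hdc] at h2
    have h3 : U₂.card * 12 * k < 2 * W.card * k := by
      calc U₂.card * 12 * k = U₂.card * (12 * k) := by ring
        _ ≤ _ := h1.trans h2
        _ < _ := (Nat.mul_lt_mul_right hk).2 hsp
    have := lt_of_mul_lt_mul_right h3 (Nat.zero_le k)
    omega
  have hUcard : U.card ≤ U'.card + V₂.card := by
    rw [hUU]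
    exact Finset.card_union_le _ _
  have := Finset.card_le_card hsub
  rw [Finset.card_union_of_disjoint hdisj] at this
  omega

lemma Expands.mono {V : Type*} [Fintype V] [DecidableEq V] {Γ Γ' : SimpleGraph V}
    (h : Expands Γ) (hle : Γ ≤ Γ') : Expands Γ' := fun U hU =>
  (h U hU).trans (Finset.card_le_card (Finset.sdiff_subset_sdiff (fun y hy => by
    obtain ⟨x, hx, hxy⟩ := mem_nbrs.1 hy
    exact mem_nbrs.2 ⟨x, hx, hle hxy⟩) subset_rfl))

/-- Adding boosters one at a time leads to a Hamilton cycle. -/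
lemma isHamiltonian_of_boosters {ω : ProcSample H n} {m₀ m₁ m t : ℕ} (h₀ : m₀ ≤ m) (h₁ : m ≤ m₁)
    (hboost : ∀ T ⊆ firstPos (numCopies H n) m₁, T.card ≤ t → Expands (unionGraph ω T) →
      ¬ (unionGraph ω T).IsHamiltonian → ∃ p ∈ firstPos (numCopies H n) m₀,
        ∃ b c, IsBooster (unionGraph ω T) b c ∧ (ω p).1.Adj b c)
    {T₀ : Finset (Fin (numCopies H n))} (hT₀ : T₀ ⊆ firstPos _ m) (ht : T₀.card + n ≤ t)
    (hexp : Expands (unionGraph ω T₀)) : (procGraph ω m).IsHamiltonian := by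
  rw [procGraph_eq]
  by_contra hno
  have hno' : ∀ T ⊆ firstPos (numCopies H n) m, ¬ (unionGraph ω T).IsHamiltonian :=
    fun T hT h => hno (h.mono (unionGraph_mono ω hT))
  have key : ∀ j, j ≤ n + 1 → ∃ T ⊆ firstPos (numCopies H n) m, T₀ ⊆ T ∧
      T.card ≤ T₀.card + j ∧ j ≤ pathOrder (unionGraph ω T) := by
    intro j
    induction j with
    | zero => exact fun _ => ⟨T₀, hT₀, subset_rfl, le_rfl, Nat.zero_le _⟩
    | succ j ih =>
      intro hj
      obtain ⟨T, hT, hsub, hcard, hpath⟩ := ih (by omega)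
      obtain ⟨p, hp, b, c, hbc, hadj⟩ := hboost T (hT.trans (firstPos_mono h₁)) (by omega)
        (hexp.mono (unionGraph_mono ω hsub)) (hno' T hT)
      have hT' : insert p T ⊆ firstPos (numCopies H n) m :=
        Finset.insert_subset (firstPos_mono h₀ hp) hT
      refine ⟨insert p T, hT', hsub.trans (Finset.subset_insert _ _),
        (Finset.card_insert_le _ _).trans (by omega), ?_⟩
      rcases hbc.2 _ (unionGraph_mono ω (Finset.subset_insert p T))
        ⟨p, Finset.mem_insert_self _ _, hadj⟩ with h | h
      · exact absurd h (hno' _ hT')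
      · omega
  obtain ⟨T, -, -, -, h⟩ := key (n + 1) le_rfl
  have := pathOrder_le_card (unionGraph ω T)
  rw [Fintype.card_fin] at this
  omega

end Structure

section Deterministic
variable {k n : ℕ} {H : SimpleGraph (Fin k)}

/-- `v` lies in fewer than `d` of the first `m` copies. -/
def IsLight (ω : ProcSample H n) (m d : ℕ) (v : Fin n) : Prop :=
  ((firstPos (numCopies H n) m).filter fun p => v ∈ verts (ω p)).card < d

/-- Light vertices are not joined by short chains among the first `m₁` copies. -/
def LightFar (ω : ProcSample H n) (m₀ m₁ d : ℕ) : Prop :=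
  ∀ u v, u ≠ v → IsLight ω m₀ d u → IsLight ω m₀ d v →
    ∀ ps : List (Fin (numCopies H n)), ps.Nodup → (∀ p ∈ ps, p ∈ firstPos _ m₁) →
      ps.length ≤ 4 → ¬ Chain ω u ps v

/-- Few of the first `m₁` copies meet a small set of vertices more than once. -/
def SmallSparse (ω : ProcSample H n) (m₁ a : ℕ) : Prop :=
  ∀ W : Finset (Fin n), W.Nonempty → W.card ≤ 6 * a →
    ((firstPos (numCopies H n) m₁).filter fun p => 2 ≤ (verts (ω p) ∩ W).card).card < 2 * W.card

/-- Large sets expand after `m` copies. -/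
def LargeExpands (ω : ProcSample H n) (m a : ℕ) : Prop :=
  ∀ U : Finset (Fin n), a < U.card → 4 * U.card ≤ n →
    2 * U.card ≤ (nbrs (unionGraph ω (firstPos _ m)) U \ U).card

/-- Every non-Hamiltonian expander made of at most `t` of the first `m₁` copies has a booster
among the first `m₀` copies. -/
def Boosted (ω : ProcSample H n) (m₀ m₁ t : ℕ) : Prop :=
  ∀ T ⊆ firstPos (numCopies H n) m₁, T.card ≤ t → Expands (unionGraph ω T) →
    ¬ (unionGraph ω T).IsHamiltonian → ∃ p ∈ firstPos (numCopies H n) m₀,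
      ∃ b c, IsBooster (unionGraph ω T) b c ∧ (ω p).1.Adj b c

lemma two_le_ncard_neighborSet_of_isHamiltonian {Γ : SimpleGraph (Fin n)} (hn : 2 ≤ n)
    (h : Γ.IsHamiltonian) (v : Fin n) : 2 ≤ (Γ.neighborSet v).ncard := by
  obtain ⟨a, p, hp⟩ := h (by rw [Fintype.card_fin]; omega)
  rw [← hp.isCycle.ncard_neighborSet_toSubgraph_eq_two (hp.mem_support v)]
  exact Set.ncard_le_ncard (p.toSubgraph.neighborSet_subset v) (Set.toFinite _)

lemma nbrs_mono {V : Type*} [Fintype V] {Γ Γ' : SimpleGraph V} (h : Γ ≤ Γ') (U : Finset V) :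
    nbrs Γ U ⊆ nbrs Γ' U := fun y hy => by
  obtain ⟨x, hx, hxy⟩ := mem_nbrs.1 hy
  exact mem_nbrs.2 ⟨x, hx, h hxy⟩

/-- The hitting times agree whenever the process has the listed properties. -/
theorem tauHam_eq_tauDeg {ω : ProcSample H n} (hk : 0 < k)
    (hiso : ∀ v, (H.neighborSet v).Nonempty) (hn : 2 ≤ n) {m m₀ m₁ a t : ℕ} (hm : m ≤ m₀)
    (ht : m + n * (12 * k + 3) ≤ t)
    (hdeg : ∀ v : Fin n, 2 ≤ ((procGraph ω m₁).neighborSet v).ncard)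
    (hmiss : ∃ v : Fin n, ∀ p ∈ firstPos (numCopies H n) m₀, v ∉ verts (ω p))
    (hfar : LightFar ω m₀ m₁ (12 * k)) (hsparse : SmallSparse ω m₁ a)
    (hlarge : LargeExpands ω m a) (hboost : Boosted ω m₀ m₁ t) :
    tauHam ω = tauDeg 2 ω := by
  classical
  have hmem : ∀ v : Fin n, 2 ≤ ((procGraph ω (tauDeg 2 ω)).neighborSet v).ncard :=
    Nat.sInf_mem (s := {i | ∀ v : Fin n, 2 ≤ ((procGraph ω i).neighborSet v).ncard}) ⟨m₁, hdeg⟩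
  have hτ₁ : tauDeg 2 ω ≤ m₁ := Nat.sInf_le hdeg
  have hnbr : ∀ v : Fin n, ∃ x y, x ≠ y ∧ (procGraph ω (tauDeg 2 ω)).Adj v x ∧
      (procGraph ω (tauDeg 2 ω)).Adj v y := by
    intro v
    obtain ⟨x, hx, y, hy, hxy⟩ := (Set.one_lt_ncard (Set.toFinite _)).1 (hmem v)
    exact ⟨x, y, hxy, hx, hy⟩
  simp only [procGraph_eq, unionGraph_adj] at hnbr
  have hτ₀ : m₀ ≤ tauDeg 2 ω := by
    by_contra! hlt
    obtain ⟨v, hv⟩ := hmiss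
    obtain ⟨x, -, -, ⟨p, hp, h⟩, -⟩ := hnbr v
    exact hv p (firstPos_mono hlt.le hp) (mem_verts_left h)
  have hT : ∀ v : Fin n, ∃ T ⊆ firstPos (numCopies H n) (tauDeg 2 ω), T.card ≤ 12 * k + 2 ∧
      2 ≤ (nbrs (unionGraph ω T) {v}).card ∧
      (¬ IsLight ω m₀ (12 * k) v → 12 * k ≤ (T.filter fun p => v ∈ verts (ω p)).card) := by
    intro v
    obtain ⟨x, y, hxy, ⟨p, hp, hpx⟩, ⟨q, hq, hqy⟩⟩ := hnbr v
    obtain ⟨R, hR, hRc, hRl⟩ : ∃ R ⊆ firstPos (numCopies H n) m₀, R.card ≤ 12 * k ∧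
        (¬ IsLight ω m₀ (12 * k) v → 12 * k ≤ (R.filter fun p => v ∈ verts (ω p)).card) := by
      by_cases hl : IsLight ω m₀ (12 * k) v
      · exact ⟨∅, Finset.empty_subset _, by simp, fun h => absurd hl h⟩
      · obtain ⟨R, hR, hRc⟩ := Finset.exists_subset_card_eq (not_lt.1 hl)
        refine ⟨R, hR.trans (Finset.filter_subset _ _), hRc.le, fun _ => ?_⟩
        rw [Finset.filter_true_of_mem fun p hp => (Finset.mem_filter.1 (hR hp)).2, hRc]
    refine ⟨insert p (insert q R), ?_, ?_, ?_, fun hl => (hRl hl).trans ?_⟩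
    · exact Finset.insert_subset hp (Finset.insert_subset hq (hR.trans (firstPos_mono hτ₀)))
    · have := Finset.card_insert_le p (insert q R)
      have := Finset.card_insert_le q R
      omega
    · rw [← Finset.card_pair hxy]
      refine Finset.card_le_card fun z hz => ?_
      simp only [Finset.mem_insert, Finset.mem_singleton] at hz
      rw [mem_nbrs]
      refine ⟨v, by simp, ?_⟩
      rcases hz with rfl | rfl
      · exact ⟨p, by simp, hpx⟩
      · exact ⟨q, by simp, hqy⟩
    · refine Finset.card_le_card (Finset.filter_subset_filter _ ?_)
      exact (Finset.subset_insert _ _).trans (Finset.subset_insert _ _)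
  choose T hTsub hTcard hTdeg hTcov using hT
  set T₀ := firstPos (numCopies H n) m ∪ Finset.univ.biUnion T with hT₀
  have hTT₀ : ∀ v, T v ⊆ T₀ := fun v => (Finset.subset_biUnion_of_mem T (Finset.mem_univ v)).trans
    Finset.subset_union_right
  have hT₀sub : T₀ ⊆ firstPos (numCopies H n) (tauDeg 2 ω) :=
    Finset.union_subset (firstPos_mono (hm.trans hτ₀)) (Finset.biUnion_subset.2 fun v _ => hTsub v)
  have hT₀card : T₀.card + n ≤ t := by
    have h1 := Finset.card_union_le (firstPos (numCopies H n) m) (Finset.univ.biUnion T)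
    rw [← hT₀] at h1
    have h2 := Finset.card_biUnion_le_card_mul Finset.univ T _ fun v _ => hTcard v
    have h3 := card_firstPos_le (numCopies H n) m
    rw [Finset.card_univ, Fintype.card_fin] at h2
    have h4 : n * (12 * k + 3) = n * (12 * k + 2) + n := by ring
    omega
  have hexp : Expands (unionGraph ω T₀) := by
    refine expands_of_sparse (S := Finset.univ.filter fun v => IsLight ω m₀ (12 * k) v) (a := a)
      hk hiso ?_ ?_ ?_ ?_ ?_
    · intro U hU hU'
      exact (hlarge U hU hU').trans (Finset.card_le_card (Finset.sdiff_subset_sdiff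
        (nbrs_mono (unionGraph_mono ω Finset.subset_union_left) U) subset_rfl))
    · exact fun v => (hTdeg v).trans (Finset.card_le_card
        (nbrs_mono (unionGraph_mono ω (hTT₀ v)) _))
    · intro u hu v hv huv w
      by_contra! hw
      obtain ⟨ps, hnd, hps, hlen, hc⟩ := exists_chain_of_walk w
      exact hfar u v huv (Finset.mem_filter.1 hu).2 (Finset.mem_filter.1 hv).2 ps hnd
        (fun p hp => firstPos_mono hτ₁ (hT₀sub (hps p hp))) (hlen.trans hw) hc
    · intro v hv
      exact (hTcov v (by simpa using hv)).trans
        (Finset.card_le_card (Finset.filter_subset_filter _ (hTT₀ v)))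
    · intro W hW hWc
      exact (Finset.card_le_card (Finset.filter_subset_filter _
        (hT₀sub.trans (firstPos_mono hτ₁)))).trans_lt (hsparse W hW hWc)
  have hHam : (procGraph ω (tauDeg 2 ω)).IsHamiltonian :=
    isHamiltonian_of_boosters hτ₀ hτ₁ hboost hT₀sub hT₀card hexp
  refine le_antisymm (Nat.sInf_le hHam) (Nat.sInf_le ?_)
  exact two_le_ncard_neighborSet_of_isHamiltonian hn
    (Nat.sInf_mem (s := {i | (procGraph ω i).IsHamiltonian}) ⟨_, hHam⟩)

end Deterministic

section FixedSets
variable {ι α : Type*} [Fintype ι] [Fintype α] [DecidableEq ι] [DecidableEq α]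

lemma determinedOn_empty_const {ι α β : Type*} (b : β) :
    DeterminedOn (∅ : Finset ι) fun _ : ι ≃ α => b := fun _ _ _ => rfl

lemma one_sub_pow_le_exp {x y : ℝ} (hxy : y ≤ x) (hx : x ≤ 1) (m : ℕ) :
    (1 - x) ^ m ≤ Real.exp (-(y * m)) := by
  calc (1 - x) ^ m ≤ (Real.exp (-y)) ^ m := by
        refine pow_le_pow_left₀ (by linarith) ?_ m
        have := Real.one_sub_le_exp_neg y
        linarith
    _ = _ := by rw [← Real.exp_nat_mul]; ring_nf

/-- The values on `R` all avoid a fixed set. -/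
lemma pr_forall_notMem_fixed_le (R : Finset ι) (F : Finset α) {y : ℝ}
    (hι : Fintype.card ι = Fintype.card α) (hpos : 0 < Fintype.card α)
    (hF : y * Fintype.card α ≤ F.card) :
    pr (fun σ : ι ≃ α => ∀ r ∈ R, σ r ∉ F) ≤ Real.exp (-(y * R.card)) := by
  have h := pr_forall_notMem_le (Q := ∅) (R := R) (Finset.disjoint_empty_left R)
    (A := fun _ => True) (B := fun _ => F) (determinedOn_empty_const True)
    (determinedOn_empty_const F) (b := F.card) (fun σ _ => by simp)
  simp only [true_and] at h
  have hpos' : (0 : ℝ) < Fintype.card α := by exact_mod_cast hpos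
  have hcard : (F.card : ℝ) ≤ Fintype.card α := by exact_mod_cast Finset.card_le_univ F
  rw [hι] at h
  have hx : (F.card : ℝ) / Fintype.card α ≤ 1 := (div_le_one hpos').2 hcard
  refine h.trans ((mul_le_of_le_one_right (pow_nonneg (by linarith) _) (pr_le_one _)).trans ?_)
  exact one_sub_pow_le_exp ((le_div_iff₀ hpos').2 hF) hx _

/-- The values on `R` all lie in a fixed set. -/
lemma pr_forall_mem_fixed_le (R : Finset ι) (F : Finset α) {b : ℝ}
    (hι : Fintype.card ι = Fintype.card α) (hpos : 0 < Fintype.card α)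
    (hR : 2 * R.card ≤ Fintype.card α) (hF : (F.card : ℝ) ≤ b * Fintype.card α) :
    pr (fun σ : ι ≃ α => ∀ r ∈ R, σ r ∈ F) ≤ (2 * b) ^ R.card := by
  have hpos' : (0 : ℝ) < Fintype.card α := by exact_mod_cast hpos
  have hR' : 2 * (R.card : ℝ) ≤ Fintype.card α := by exact_mod_cast hR
  have h := pr_forall_mem_le (Q := ∅) (R := R) (Finset.disjoint_empty_left R)
    (A := fun _ => True) (determinedOn_empty_const True) F (q := Fintype.card α / 2) hF
    (by simp only [Finset.card_empty]; push_cast; linarith) (by rw [hι]; linarith)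
  simp only [true_and] at h
  have hb : b * Fintype.card α / (Fintype.card ι - Fintype.card α / 2) = 2 * b := by
    rw [hι]
    field_simp
    norm_num
  have hb0 : 0 ≤ b := nonneg_of_mul_nonneg_left (le_trans (by positivity) hF) hpos'
  rw [hb] at h
  exact h.trans (mul_le_of_le_one_right (by positivity) (pr_le_one _))

end FixedSets

section Degree
variable {k n : ℕ} {H : SimpleGraph (Fin k)}

lemma card_fin_numCopies : Fintype.card (Fin (numCopies H n)) = Fintype.card (Copy H n) := by
  rw [Fintype.card_fin, numCopies_eq]

lemma card_copies_mem_real (hiso : ∀ v, (H.neighborSet v).Nonempty) (v : Fin n) :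
    ((Finset.univ.filter fun c : Copy H n => v ∈ verts c).card : ℝ) = k / n * numCopies H n := by
  have hn : (0 : ℝ) < n := by exact_mod_cast v.pos
  have h : (n : ℝ) * (Finset.univ.filter fun c : Copy H n => v ∈ verts c).card =
      k * numCopies H n := by
    have := card_copies_mem (H := H) hiso v
    exact_mod_cast this
  field_simp
  linarith

lemma card_copies_mem_mem_real (hk : 0 < k) (hiso : ∀ v, (H.neighborSet v).Nonempty)
    {u v : Fin n} (huv : u ≠ v) : ((Finset.univ.filter fun c : Copy H n => u ∈ verts c ∧ v ∈ verts c).card : ℝ) =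
      k * (k - 1) / (n * (n - 1)) * numCopies H n := by
  have hn2 : 2 ≤ n := by
    have := Fin.val_ne_of_ne huv
    omega
  have hn : (2 : ℝ) ≤ n := by exact_mod_cast hn2
  have h := card_copies_mem_mem (H := H) hiso huv
  have h' : (n : ℝ) * (n - 1) *
      (Finset.univ.filter fun c : Copy H n => u ∈ verts c ∧ v ∈ verts c).card =
      k * (k - 1) * numCopies H n := by
    rw [← Nat.cast_pred (by omega), ← Nat.cast_pred (n := k) (by omega)]
    exact_mod_cast h
  have : (0 : ℝ) < n - 1 := by linarith
  field_simp
  linarith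

lemma card_copies_mem_notMem (hk : 0 < k) (hiso : ∀ v, (H.neighborSet v).Nonempty)
    {u v : Fin n} (huv : u ≠ v) (hkn : 2 * k ≤ n) : 1 / (2 * n) * (numCopies H n : ℝ) ≤
      (Finset.univ.filter fun c : Copy H n => u ∈ verts c ∧ v ∉ verts c).card := by
  have h1 := Finset.card_filter_add_card_filter_not (s := Finset.univ.filter
    fun c : Copy H n => u ∈ verts c) (fun c => v ∈ verts c)
  rw [Finset.filter_filter, Finset.filter_filter] at h1
  have h2 : ((Finset.univ.filter fun c : Copy H n => u ∈ verts c ∧ v ∈ verts c).card : ℝ) +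
      (Finset.univ.filter fun c : Copy H n => u ∈ verts c ∧ v ∉ verts c).card =
      (Finset.univ.filter fun c : Copy H n => u ∈ verts c).card := by exact_mod_cast h1
  rw [card_copies_mem_real hiso, card_copies_mem_mem_real hk hiso huv] at h2
  have hk1 : (1 : ℝ) ≤ k := by exact_mod_cast hk
  have hkn' : 2 * (k : ℝ) ≤ n := by exact_mod_cast hkn
  have hn1 : (0 : ℝ) < n - 1 := by linarith
  have hn0 : (0 : ℝ) < n := by linarith
  have h3 : (k : ℝ) * (k - 1) / (n * (n - 1)) ≤ k / n - 1 / (2 * n) := by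
    rw [div_sub_div _ _ hn0.ne' (by positivity), div_le_div_iff₀ (by positivity) (by positivity)]
    have : (k : ℝ) * (k - 1) * 2 ≤ (2 * k - 1) * (n - 1) := by nlinarith
    nlinarith [mul_le_mul_of_nonneg_left this (by positivity : (0 : ℝ) ≤ (n : ℝ) ^ 2)]
  have := mul_le_mul_of_nonneg_right h3 (Nat.cast_nonneg (α := ℝ) (numCopies H n))
  linarith

/-- Minimum degree at least two. -/
lemma pr_not_two_le_degree_le (hk : 0 < k) (hiso : ∀ v, (H.neighborSet v).Nonempty)
    (hkn : 2 * k ≤ n) {m : ℕ} (hm : m ≤ numCopies H n) :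
    pr (fun ω : ProcSample H n => ¬ ∀ v, 2 ≤ ((procGraph ω m).neighborSet v).ncard) ≤
      n ^ 2 * Real.exp (-(1 / (2 * n) * m)) := by
  have hstep : ∀ ω : ProcSample H n, (¬ ∀ v, 2 ≤ ((procGraph ω m).neighborSet v).ncard) →
      ∃ e ∈ (Finset.univ : Finset (Fin n)).offDiag, ∀ p ∈ firstPos (numCopies H n) m,
        ω p ∉ Finset.univ.filter fun c : Copy H n => e.1 ∈ verts c ∧ e.2 ∉ verts c := by
    intro ω h
    push Not at h
    obtain ⟨v, hv⟩ := h
    obtain ⟨x, hxv, hx⟩ : ∃ x, v ≠ x ∧ ∀ y, (procGraph ω m).Adj v y → y = x := by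
      have hss := Set.ncard_le_one_iff_subsingleton.1 (Nat.lt_succ_iff.1 hv)
      rcases ((procGraph ω m).neighborSet v).eq_empty_or_nonempty with h0 | ⟨x, hx⟩
      · have : Nontrivial (Fin n) := Fin.nontrivial_iff_two_le.2 (by omega)
        obtain ⟨x, hx⟩ := exists_ne v
        exact ⟨x, hx.symm, fun y hy => absurd (h0 ▸ hy : y ∈ (∅ : Set (Fin n))) (by simp)⟩
      · exact ⟨x, ((procGraph ω m).mem_neighborSet v x |>.1 hx).ne, fun y hy => hss hy hx⟩
    refine ⟨(v, x), by simpa using hxv, fun p hp hmem => ?_⟩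
    obtain ⟨h1, h2⟩ := (Finset.mem_filter.1 hmem).2
    obtain ⟨w, hw⟩ := mem_verts.1 h1
    have := hx w (by rw [procGraph_eq]; exact ⟨p, hp, hw⟩)
    exact h2 (this ▸ mem_verts_right hw)
  refine (pr_mono hstep).trans ((pr_exists_le _ _).trans ?_)
  have hpos : 0 < numCopies H n := numCopies_pos (by omega)
  refine (Finset.sum_le_card_nsmul _ _ (Real.exp (-(1 / (2 * n) * m))) fun e he => ?_).trans ?_
  · have := pr_forall_notMem_fixed_le (firstPos (numCopies H n) m)
      (Finset.univ.filter fun c : Copy H n => e.1 ∈ verts c ∧ e.2 ∉ verts c) (y := 1 / (2 * n))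
      card_fin_numCopies (by rwa [← numCopies_eq]) (by
        rw [← numCopies_eq]
        exact card_copies_mem_notMem hk hiso (by simpa using he) hkn)
    rwa [card_firstPos hm] at this
  · rw [nsmul_eq_mul, Finset.offDiag_card, Finset.card_univ, Fintype.card_fin]
    gcongr
    rw [sq]
    exact_mod_cast Nat.sub_le _ _

end Degree

section Expansion
variable {k n : ℕ} {H : SimpleGraph (Fin k)}

open Classical in
lemma card_copies_hit_real (hk : 0 < k) (hiso : ∀ v, (H.neighborSet v).Nonempty)
    (E : Finset (Fin n × Fin n)) (hE : ∀ e ∈ E, e.1 ≠ e.2) (hn : 2 ≤ n) :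
    (E.card : ℝ) / n ^ 2 * numCopies H n ≤
      (Finset.univ.filter fun c : Copy H n => ∃ e ∈ E, c.1.Adj e.1 e.2).card := by
  have h : (E.card : ℝ) * numCopies H n ≤ n * n *
      (Finset.univ.filter fun c : Copy H n => ∃ e ∈ E, c.1.Adj e.1 e.2).card := by
    have := (card_copies_hit hk hiso E hE).trans
      (Nat.mul_le_mul_right _ (Nat.mul_le_mul_left n (Nat.sub_le n 1)))
    exact_mod_cast this
  have : (0 : ℝ) < n := by
    exact_mod_cast (by omega : 0 < n)
  rw [div_mul_eq_mul_div, div_le_iff₀ (by positivity)]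
  linarith

lemma choose_le_exp_mul_div_pow {n s : ℕ} (hs : 0 < s) :
    (n.choose s : ℝ) ≤ (Real.exp 1 * (n / s)) ^ s := by
  have h1 := Nat.choose_le_pow_div (α := ℝ) s n
  have h2 := Real.pow_div_factorial_le_exp (s : ℝ) (by positivity) s
  have hs' : (0 : ℝ) < s := by exact_mod_cast hs
  have hf : (0 : ℝ) < s.factorial := by exact_mod_cast s.factorial_pos
  have h3 : 1 / (s.factorial : ℝ) ≤ Real.exp s / s ^ s := by
    rw [div_le_iff₀ hf] at h2
    rw [div_le_div_iff₀ hf (by positivity)]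
    linarith
  calc (n.choose s : ℝ) ≤ n ^ s * (1 / s.factorial) := by rw [mul_one_div]; exact h1
    _ ≤ n ^ s * (Real.exp s / s ^ s) := by gcongr
    _ = _ := by
      rw [mul_pow, div_pow, ← Real.exp_nat_mul, mul_one]
      ring

lemma sum_pow_le_two_mul {ρ : ℝ} (h0 : 0 ≤ ρ) (h1 : ρ ≤ 1 / 2) (m : ℕ) :
    ∑ s ∈ Finset.Icc 1 m, ρ ^ s ≤ 2 * ρ := by
  have : ∀ m : ℕ, ∑ s ∈ Finset.range m, ρ ^ s ≤ 2 := fun m => by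
    refine (Summable.sum_le_tsum _ (fun _ _ => by positivity)
      (summable_geometric_of_lt_one h0 (by linarith))).trans ?_
    rw [tsum_geometric_of_lt_one h0 (by linarith), inv_le_comm₀ (by linarith) (by norm_num)]
    linarith
  have h2 : ∑ s ∈ Finset.Icc 1 m, ρ ^ s = ρ * ∑ s ∈ Finset.range m, ρ ^ s := by
    have h3 := Finset.sum_Ico_add' (fun s => ρ ^ s) 0 m 1
    rw [Finset.mul_sum, Finset.range_eq_Ico]
    simp only [pow_succ'] at h3
    rw [h3]
    exact Finset.sum_congr (by ext; simp) fun _ _ => rfl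
  rw [h2]
  nlinarith [this m]

open Classical in
lemma pr_exists_card_nbrs_lt_le (hk : 0 < k) (hiso : ∀ v, (H.neighborSet v).Nonempty)
    (hkn : 2 * k ≤ n) {m s : ℕ} (hm : m ≤ numCopies H n) {x : ℝ} (hx : n ≤ x * s) (hs : 0 < s)
    (hsn : 4 * s ≤ n) :
    pr (fun ω : ProcSample H n => ∃ U : Finset (Fin n), U.card = s ∧
      (nbrs (unionGraph ω (firstPos _ m)) U \ U).card < 2 * s) ≤
      (Real.exp 3 * x ^ 3 * Real.exp (-(m / (4 * n)))) ^ s := by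
  let E : Finset (Fin n) × Finset (Fin n) → Finset (Fin n × Fin n) := fun f =>
    f.1 ×ˢ (f.1 ∪ f.2)ᶜ
  let F : Finset (Fin n) × Finset (Fin n) → Finset (Copy H n) := fun f =>
    Finset.univ.filter fun c : Copy H n => ∃ e ∈ E f, c.1.Adj e.1 e.2
  have hstep : ∀ ω : ProcSample H n, (∃ U : Finset (Fin n), U.card = s ∧
      (nbrs (unionGraph ω (firstPos _ m)) U \ U).card < 2 * s) →
      ∃ f ∈ Finset.univ.powersetCard s ×ˢ Finset.univ.powersetCard (2 * s),
        ∀ p ∈ firstPos (numCopies H n) m, ω p ∉ F f := by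
    rintro ω ⟨U, hU, hlt⟩
    obtain ⟨W, hW, hWc⟩ := Finset.exists_superset_card_eq hlt.le
      (by rw [Fintype.card_fin]; omega)
    refine ⟨(U, W), by simp [hU, hWc], fun p hp hmem => ?_⟩
    obtain ⟨e, he, hadj⟩ := (Finset.mem_filter.1 hmem).2
    simp only [E, Finset.mem_product, Finset.mem_compl, Finset.mem_union, not_or] at he
    exact he.2.2 (hW (Finset.mem_sdiff.2 ⟨mem_nbrs.2 ⟨e.1, he.1, p, hp, hadj⟩, he.2.1⟩))
  have hn0 : (0 : ℝ) < n := by exact_mod_cast (by omega : 0 < n)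
  have hs0 : (0 : ℝ) < s := by exact_mod_cast hs
  have hx0 : 0 < x := pos_of_mul_pos_left (hn0.trans_le hx) hs0.le
  refine (pr_mono hstep).trans ((pr_exists_le _ _).trans ?_)
  have hpos : 0 < numCopies H n := numCopies_pos (by omega)
  refine (Finset.sum_le_card_nsmul _ _ (Real.exp (-(s / (4 * n) * m))) fun f hf => ?_).trans ?_
  · have hf' := Finset.mem_product.1 hf
    have h1 := (Finset.mem_powersetCard.1 hf'.1).2
    have h2 := (Finset.mem_powersetCard.1 hf'.2).2
    have h3 := Finset.card_union_le f.1 f.2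
    have h4 := Finset.card_compl_add_card (f.1 ∪ f.2)
    rw [Fintype.card_fin] at h4
    have hE : (s : ℝ) * n ≤ 4 * (E f).card := by
      have : s * n ≤ 4 * (E f).card := by
        rw [Finset.card_product, h1]
        calc s * n ≤ s * (4 * ((f.1 ∪ f.2)ᶜ).card) := Nat.mul_le_mul_left _ (by omega)
          _ = _ := by ring
      exact_mod_cast this
    have := pr_forall_notMem_fixed_le (firstPos (numCopies H n) m) (F f) (y := s / (4 * n))
      card_fin_numCopies (by rwa [← numCopies_eq]) (by
        rw [← numCopies_eq]
        refine le_trans ?_ (card_copies_hit_real hk hiso (E f) ?_ (by omega))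
        · gcongr ?_ * _
          rw [div_le_div_iff₀ (by positivity) (by positivity)]
          nlinarith
        · rintro ⟨a, b⟩ he hab
          simp only [E, Finset.mem_product, Finset.mem_compl, Finset.mem_union, not_or] at he
          exact he.2.1 ((show a = b from hab) ▸ he.1))
    rwa [card_firstPos hm] at this
  · rw [nsmul_eq_mul, Finset.card_product, Finset.card_powersetCard, Finset.card_powersetCard,
      Finset.card_univ, Fintype.card_fin, Nat.cast_mul]
    have h1 : (n.choose s : ℝ) ≤ (Real.exp 1 * x) ^ s := by
      refine (choose_le_exp_mul_div_pow hs).trans ?_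
      gcongr
      rwa [div_le_iff₀ hs0]
    have h2 : (n.choose (2 * s) : ℝ) ≤ (Real.exp 1 * x) ^ (2 * s) := by
      refine (choose_le_exp_mul_div_pow (by omega)).trans ?_
      gcongr
      rw [div_le_iff₀ (by positivity)]
      push_cast
      nlinarith
    calc (n.choose s : ℝ) * n.choose (2 * s) * Real.exp (-(s / (4 * n) * m)) ≤
        (Real.exp 1 * x) ^ s * (Real.exp 1 * x) ^ (2 * s) * Real.exp (-(s / (4 * n) * m)) := by
          gcongr
      _ = _ := by
        have h3 : Real.exp 3 = Real.exp 1 ^ 3 := by rw [← Real.exp_nat_mul]; norm_num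
        have h4 : Real.exp (-(s / (4 * n) * m)) = Real.exp (-(m / (4 * n))) ^ s := by
          rw [← Real.exp_nat_mul]
          congr 1
          ring
        rw [h3, h4]
        ring

lemma pr_exists_Icc_le {Ω : ℕ → ProcSample H n → Prop} {ρ : ℝ} {m : ℕ} (h0 : 0 ≤ ρ)
    (h1 : ρ ≤ 1 / 2) (h : ∀ s ∈ Finset.Icc 1 m, pr (Ω s) ≤ ρ ^ s) :
    pr (fun ω => ∃ s ∈ Finset.Icc 1 m, Ω s ω) ≤ 2 * ρ :=
  (pr_exists_le _ _).trans ((Finset.sum_le_sum h).trans (sum_pow_le_two_mul h0 h1 m))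

lemma pr_false {ι α : Type*} : pr (fun _ : ι ≃ α => False) = 0 := by simp [pr]

/-- Expansion of large sets. -/
lemma pr_not_largeExpands_le (hk : 0 < k) (hiso : ∀ v, (H.neighborSet v).Nonempty)
    (hkn : 2 * k ≤ n) {m a : ℕ} (hm : m ≤ numCopies H n) {x ρ : ℝ} (hx : 0 < x)
    (ha : ∀ s : ℕ, a < s → n ≤ x * s)
    (hρ : Real.exp 3 * x ^ 3 * Real.exp (-(m / (4 * n))) ≤ ρ) (hρ1 : ρ ≤ 1 / 2) :
    pr (fun ω : ProcSample H n => ¬ LargeExpands ω m a) ≤ 2 * ρ := by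
  classical
  have hρ0 : 0 ≤ ρ := le_trans (by positivity) hρ
  refine (pr_mono fun ω h => ?_).trans (pr_exists_Icc_le (m := n) (Ω := fun s ω =>
    a < s ∧ 4 * s ≤ n ∧ ∃ U : Finset (Fin n), U.card = s ∧
      (nbrs (unionGraph ω (firstPos _ m)) U \ U).card < 2 * s) hρ0 hρ1 fun s hs => ?_)
  · unfold LargeExpands at h
    push Not at h
    obtain ⟨U, hU, hUn, hlt⟩ := h
    exact ⟨U.card, Finset.mem_Icc.2 ⟨by omega, by omega⟩, hU, hUn, U, rfl, by convert hlt⟩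
  · by_cases hs' : a < s ∧ 4 * s ≤ n
    · refine (pr_mono fun ω h => h.2.2).trans ((pr_exists_card_nbrs_lt_le hk hiso hkn hm
        (ha s hs'.1) (Finset.mem_Icc.1 hs).1 hs'.2).trans ?_)
      gcongr
    · refine (pr_mono fun ω h => hs' ⟨h.1, h.2.1⟩).trans ?_
      rw [pr_false]
      positivity

end Expansion

section Sparse
variable {k n : ℕ} {H : SimpleGraph (Fin k)}

lemma card_copies_mem_mem_le (hk : 0 < k) (hiso : ∀ v, (H.neighborSet v).Nonempty)
    (hkn : k ≤ n) {u v : Fin n} (huv : u ≠ v) :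
    ((Finset.univ.filter fun c : Copy H n => u ∈ verts c ∧ v ∈ verts c).card : ℝ) ≤
      k ^ 2 / n ^ 2 * numCopies H n := by
  have hn2 : 2 ≤ n := by
    have := Fin.val_ne_of_ne huv
    omega
  have hn : (2 : ℝ) ≤ n := by exact_mod_cast hn2
  have hkn' : (k : ℝ) ≤ n := by exact_mod_cast hkn
  have hk' : (0 : ℝ) < k := by exact_mod_cast hk
  have hn1 : (0 : ℝ) < n - 1 := by linarith
  rw [card_copies_mem_mem_real hk hiso huv]
  gcongr ?_ * _
  rw [div_le_div_iff₀ (by positivity) (by positivity)]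
  have : ((k : ℝ) - 1) * n ≤ k * (n - 1) := by linarith
  nlinarith [mul_le_mul_of_nonneg_left this (by positivity : (0 : ℝ) ≤ (k : ℝ) * n)]

lemma card_copies_two_le_inter_le (hk : 0 < k) (hiso : ∀ v, (H.neighborSet v).Nonempty)
    (hkn : k ≤ n) (W : Finset (Fin n)) :
    ((Finset.univ.filter fun c : Copy H n => 2 ≤ (verts c ∩ W).card).card : ℝ) ≤
      W.card ^ 2 * k ^ 2 / n ^ 2 * numCopies H n := by
  classical
  have hsub : (Finset.univ.filter fun c : Copy H n => 2 ≤ (verts c ∩ W).card) ⊆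
      W.offDiag.biUnion fun e => Finset.univ.filter fun c => e.1 ∈ verts c ∧ e.2 ∈ verts c := by
    intro c hc
    obtain ⟨a, ha, b, hb, hab⟩ := Finset.one_lt_card.1 (Finset.mem_filter.1 hc).2
    rw [Finset.mem_inter] at ha hb
    simp only [Finset.mem_biUnion, Finset.mem_offDiag, Finset.mem_filter, Finset.mem_univ, true_and]
    exact ⟨(a, b), ⟨ha.2, hb.2, hab⟩, ha.1, hb.1⟩
  have h1 : ((Finset.univ.filter fun c : Copy H n => 2 ≤ (verts c ∩ W).card).card : ℝ) ≤
      ∑ e ∈ W.offDiag, ((Finset.univ.filter fun c : Copy H n =>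
        e.1 ∈ verts c ∧ e.2 ∈ verts c).card : ℝ) := by
    exact_mod_cast (Finset.card_le_card hsub).trans Finset.card_biUnion_le
  refine h1.trans ((Finset.sum_le_card_nsmul _ _ (k ^ 2 / n ^ 2 * (numCopies H n : ℝ))
    fun e he => card_copies_mem_mem_le hk hiso hkn (Finset.mem_offDiag.1 he).2.2).trans ?_)
  rw [nsmul_eq_mul, mul_div_assoc, mul_assoc]
  gcongr
  rw [Finset.offDiag_card, sq]
  exact_mod_cast Nat.sub_le _ _

lemma pr_exists_two_le_inter_le (hk : 0 < k) (hiso : ∀ v, (H.neighborSet v).Nonempty)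
    (hkn : k ≤ n) {m s : ℕ} (hm : 2 * m ≤ numCopies H n) {l z : ℝ} (hl : m ≤ n * l)
    (hz : s ≤ z * n) (hs : 0 < s) :
    pr (fun ω : ProcSample H n => ∃ W : Finset (Fin n), W.card = s ∧
      2 * s ≤ ((firstPos (numCopies H n) m).filter fun p => 2 ≤ (verts (ω p) ∩ W).card).card) ≤
      (Real.exp 3 * k ^ 4 * l ^ 2 * z) ^ s := by
  let F : Finset (Fin n) → Finset (Copy H n) := fun W =>
    Finset.univ.filter fun c : Copy H n => 2 ≤ (verts c ∩ W).card
  have hstep : ∀ ω : ProcSample H n, (∃ W : Finset (Fin n), W.card = s ∧ 2 * s ≤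
      ((firstPos (numCopies H n) m).filter fun p => 2 ≤ (verts (ω p) ∩ W).card).card) →
      ∃ f ∈ Finset.univ.powersetCard s ×ˢ (firstPos (numCopies H n) m).powersetCard (2 * s),
        ∀ p ∈ f.2, ω p ∈ F f.1 := by
    rintro ω ⟨W, hW, hle⟩
    obtain ⟨R, hR, hRc⟩ := Finset.exists_subset_card_eq hle
    refine ⟨(W, R), ?_, fun p hp => ?_⟩
    · simp only [Finset.mem_product, Finset.mem_powersetCard]
      exact ⟨⟨Finset.subset_univ _, hW⟩, hR.trans (Finset.filter_subset _ _), hRc⟩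
    · exact Finset.mem_filter.2 ⟨Finset.mem_univ _, (Finset.mem_filter.1 (hR hp)).2⟩
  have hn0 : (0 : ℝ) < n := by exact_mod_cast (by omega : 0 < n)
  have hs0 : (0 : ℝ) < s := by exact_mod_cast hs
  have hpos : 0 < numCopies H n := numCopies_pos hkn
  have hl0 : 0 ≤ l := nonneg_of_mul_nonneg_right ((Nat.cast_nonneg m).trans hl) hn0
  refine (pr_mono hstep).trans ((pr_exists_le _ _).trans ?_)
  refine (Finset.sum_le_card_nsmul _ _ ((2 * (s ^ 2 * k ^ 2 / n ^ 2 : ℝ)) ^ (2 * s))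
    fun f hf => ?_).trans ?_
  · have hf' := Finset.mem_product.1 hf
    have h1 := (Finset.mem_powersetCard.1 hf'.1).2
    have h2 := Finset.mem_powersetCard.1 hf'.2
    have h3 := (Finset.card_le_card h2.1).trans (card_firstPos_le _ _)
    have h4 := card_copies_two_le_inter_le (H := H) hk hiso hkn f.1
    rw [h1] at h4
    have := pr_forall_mem_fixed_le f.2 (F f.1) card_fin_numCopies (by rwa [← numCopies_eq])
      (by rw [← numCopies_eq]; omega) (by rw [← numCopies_eq]; exact h4)
    rwa [h2.2] at this
  · rw [nsmul_eq_mul, Finset.card_product, Finset.card_powersetCard, Finset.card_powersetCard,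
      Finset.card_univ, Fintype.card_fin, Nat.cast_mul]
    have h1 := choose_le_exp_mul_div_pow (n := n) hs
    have h2 : (((firstPos (numCopies H n) m).card.choose (2 * s) : ℕ) : ℝ) ≤
        (Real.exp 1 * (n * l / (2 * s))) ^ (2 * s) := by
      rw [card_firstPos (by omega)]
      refine (choose_le_exp_mul_div_pow (by omega)).trans ?_
      push_cast
      gcongr
    calc (n.choose s : ℝ) * ((firstPos (numCopies H n) m).card.choose (2 * s) : ℕ) *
          (2 * (s ^ 2 * k ^ 2 / n ^ 2 : ℝ)) ^ (2 * s) ≤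
        (Real.exp 1 * (n / s)) ^ s * (Real.exp 1 * (n * l / (2 * s))) ^ (2 * s) *
          (2 * (s ^ 2 * k ^ 2 / n ^ 2 : ℝ)) ^ (2 * s) := by gcongr
      _ = (Real.exp 3 * k ^ 4 * l ^ 2 * (s / n)) ^ s := by
        have h3 : Real.exp 3 = Real.exp 1 ^ 3 := by rw [← Real.exp_nat_mul]; norm_num
        rw [pow_mul, pow_mul, ← mul_pow, ← mul_pow, h3]
        congr 1
        field_simp
      _ ≤ _ := by
        gcongr
        rwa [div_le_iff₀ hn0]

/-- Small sets of vertices are met more than once by few copies. -/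
lemma pr_not_smallSparse_le (hk : 0 < k) (hiso : ∀ v, (H.neighborSet v).Nonempty)
    (hkn : k ≤ n) {m a : ℕ} (hm : 2 * m ≤ numCopies H n) {l z ρ : ℝ} (hl : m ≤ n * l)
    (hz : ∀ s : ℕ, s ≤ 6 * a → s ≤ z * n) (hρ : Real.exp 3 * k ^ 4 * l ^ 2 * z ≤ ρ)
    (hρ1 : ρ ≤ 1 / 2) :
    pr (fun ω : ProcSample H n => ¬ SmallSparse ω m a) ≤ 2 * ρ := by
  have hn0 : (0 : ℝ) < n := by exact_mod_cast (by omega : 0 < n)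
  have hz0 : 0 ≤ z := by
    have := hz 0 (Nat.zero_le _)
    rw [Nat.cast_zero] at this
    exact nonneg_of_mul_nonneg_left this hn0
  have hρ0 : 0 ≤ ρ := le_trans (by positivity) hρ
  refine (pr_mono fun ω h => ?_).trans (pr_exists_Icc_le (m := 6 * a) (Ω := fun s ω =>
    ∃ W : Finset (Fin n), W.card = s ∧ 2 * s ≤
      ((firstPos (numCopies H n) m).filter fun p => 2 ≤ (verts (ω p) ∩ W).card).card)
    hρ0 hρ1 fun s hs => ?_)
  · unfold SmallSparse at h
    push Not at h
    obtain ⟨W, hW, hWa, hle⟩ := h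
    exact ⟨W.card, Finset.mem_Icc.2 ⟨hW.card_pos, hWa⟩, W, rfl, hle⟩
  · have hs' := Finset.mem_Icc.1 hs
    refine (pr_exists_two_le_inter_le hk hiso hkn hm hl (hz s hs'.2) hs'.1).trans ?_
    gcongr

end Sparse

section Boosters
variable {k n : ℕ} {H : SimpleGraph (Fin k)}

lemma card_filter_card_le_le {ι : Type*} (P : Finset ι) (t : ℕ) {x : ℝ} (hx : 0 < x)
    (hx1 : x ≤ 1) :
    ((P.powerset.filter fun T => T.card ≤ t).card : ℝ) ≤ (x ^ t)⁻¹ * Real.exp (x * P.card) := by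
  have h1 : ∑ T ∈ P.powerset, x ^ T.card = (1 + x) ^ P.card := by
    have := Finset.sum_pow_mul_eq_add_pow x 1 P
    simpa [add_comm] using this
  have h2 : ((P.powerset.filter fun T => T.card ≤ t).card : ℝ) * x ^ t ≤ (1 + x) ^ P.card := by
    rw [← h1, ← nsmul_eq_mul]
    refine (Finset.card_nsmul_le_sum _ (fun T => x ^ T.card) _ fun T hT => ?_).trans
      (Finset.sum_le_sum_of_subset_of_nonneg (Finset.filter_subset _ _) fun _ _ _ => by positivity)
    exact pow_le_pow_of_le_one hx.le hx1 (Finset.mem_filter.1 hT).2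
  have h3 : (1 + x) ^ P.card ≤ Real.exp (x * P.card) := by
    rw [mul_comm, Real.exp_nat_mul]
    gcongr
    linarith [Real.add_one_le_exp x]
  rw [inv_mul_eq_div, le_div_iff₀ (by positivity)]
  exact h2.trans h3

lemma unionGraph_congr {ω ω' : ProcSample H n} {T : Finset (Fin (numCopies H n))}
    (h : ∀ p ∈ T, ω p = ω' p) : unionGraph ω T = unionGraph ω' T := by
  ext x y
  simp only [unionGraph_adj]
  exact exists_congr fun p => and_congr_right fun hp => by rw [h p hp]

open Classical in
/-- Non-Hamiltonian expanders made of few copies have boosters among the first copies. -/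
lemma pr_not_boosted_le (hk : 0 < k) (hiso : ∀ v, (H.neighborSet v).Nonempty) (hkn : k ≤ n)
    (hn : 12 ≤ n) {m₀ m₁ t : ℕ} (hm₀ : m₀ ≤ numCopies H n) (hm₁ : m₁ ≤ numCopies H n)
    {x : ℝ} (hx : 0 < x) (hx1 : x ≤ 1) :
    pr (fun ω : ProcSample H n => ¬ Boosted ω m₀ m₁ t) ≤
      (x ^ t)⁻¹ * Real.exp (x * m₁) * Real.exp (-(1 / 16 * (m₀ - t))) := by
  let E : Finset (Fin (numCopies H n)) → ProcSample H n → Finset (Fin n × Fin n) := fun T ω =>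
    Finset.univ.filter fun e => IsBooster (unionGraph ω T) e.1 e.2
  let B : Finset (Fin (numCopies H n)) → ProcSample H n → Finset (Copy H n) := fun T ω =>
    Finset.univ.filter fun c : Copy H n => ∃ e ∈ E T ω, c.1.Adj e.1 e.2
  let A : Finset (Fin (numCopies H n)) → ProcSample H n → Prop := fun T ω =>
    Expands (unionGraph ω T) ∧ ¬ (unionGraph ω T).IsHamiltonian
  let S := (firstPos (numCopies H n) m₁).powerset.filter fun T => T.card ≤ t
  have hstep : ∀ ω : ProcSample H n, ¬ Boosted ω m₀ m₁ t → ∃ T ∈ S,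
      A T ω ∧ ∀ p ∈ firstPos (numCopies H n) m₀ \ T, ω p ∉ B T ω := by
    intro ω h
    unfold Boosted at h
    push Not at h
    obtain ⟨T, hT, hTt, hexp, hham, hno⟩ := h
    refine ⟨T, Finset.mem_filter.2 ⟨Finset.mem_powerset.2 hT, hTt⟩, ⟨hexp, hham⟩,
      fun p hp hmem => ?_⟩
    obtain ⟨e, he, hadj⟩ := (Finset.mem_filter.1 hmem).2
    exact hno p (Finset.mem_sdiff.1 hp).1 e.1 e.2 (Finset.mem_filter.1 he).2 hadj
  have hpos : 0 < numCopies H n := numCopies_pos hkn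
  have hN : (0 : ℝ) < numCopies H n := by exact_mod_cast hpos
  refine (pr_mono hstep).trans ((pr_exists_le _ _).trans ?_)
  refine (Finset.sum_le_card_nsmul _ _ (Real.exp (-(1 / 16 * (m₀ - t)))) fun T hT => ?_).trans ?_
  · have hTt := (Finset.mem_filter.1 hT).2
    have h1 := pr_forall_notMem_le (Q := T) (R := firstPos (numCopies H n) m₀ \ T)
      Finset.disjoint_sdiff (A := A T) (B := B T) (b := 1 / 16 * numCopies H n)
      (fun ω ω' h => by simp only [A, unionGraph_congr h])
      (fun ω ω' h => by simp only [B, E, unionGraph_congr h]) (fun ω hω => ?_)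
    · refine h1.trans ((mul_le_of_le_one_right ?_ (pr_le_one _)).trans ?_)
      · rw [Fintype.card_fin, mul_div_assoc, div_self hN.ne']
        positivity
      · rw [Fintype.card_fin, mul_div_assoc, div_self hN.ne', mul_one]
        refine (one_sub_pow_le_exp le_rfl (by norm_num) _).trans ?_
        have h2 : m₀ ≤ (firstPos (numCopies H n) m₀ \ T).card + t := by
          have := Finset.le_card_sdiff T (firstPos (numCopies H n) m₀)
          rw [card_firstPos hm₀] at this
          omega
        have h3 : (m₀ : ℝ) ≤ (firstPos (numCopies H n) m₀ \ T).card + t := by exact_mod_cast h2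
        gcongr
        linarith
    · have hdisj : B T ω \ T.image ω = B T ω := by
        rw [Finset.sdiff_eq_self_iff_disjoint, Finset.disjoint_left]
        intro c hc hc'
        obtain ⟨p, hp, rfl⟩ := Finset.mem_image.1 hc'
        obtain ⟨e, he, hadj⟩ := (Finset.mem_filter.1 hc).2
        rcases (Finset.mem_filter.1 he).2.2 _ le_rfl ⟨p, hp, hadj⟩ with h | h
        · exact hω.2 h
        · exact lt_irrefl _ h
      rw [hdisj]
      refine le_trans ?_ (card_copies_hit_real hk hiso (E T ω)
        (fun e he => (Finset.mem_filter.1 he).2.1) (by omega))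
      have hb := hω.1.card_boosters (by rwa [Fintype.card_fin])
      rw [Fintype.card_fin] at hb
      have hb' : (n : ℝ) ^ 2 ≤ 16 * (E T ω).card := by exact_mod_cast hb
      have hn0 : (0 : ℝ) < n := by exact_mod_cast (by omega : 0 < n)
      gcongr ?_ * _
      rw [div_le_div_iff₀ (by norm_num) (by positivity)]
      linarith
  · rw [nsmul_eq_mul]
    gcongr
    have := card_filter_card_le_le (firstPos (numCopies H n) m₁) t hx hx1
    rwa [card_firstPos hm₁] at this

end Boosters

section SecondMoment
variable {ι α β : Type*} [Fintype ι] [Fintype α] [DecidableEq ι] [DecidableEq α]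

/-- Chebyshev's inequality for the number of events that occur. -/
lemma pr_forall_not_le [Nonempty (ι ≃ α)] (s : Finset β) (P : β → (ι ≃ α) → Prop) {f : ℝ}
    (hf : 0 < f) (hs : s.Nonempty) (h1 : ∀ b ∈ s, pr (P b) = f)
    (h2 : ∀ b ∈ s, ∀ c ∈ s, b ≠ c → pr (fun σ => P b σ ∧ P c σ) ≤ f ^ 2) :
    pr (fun σ => ∀ b ∈ s, ¬ P b σ) ≤ (s.card * f)⁻¹ := by
  classical
  let M : ℝ := Fintype.card (ι ≃ α)
  have hM : 0 < M := by
    exact Nat.cast_pos.2 Fintype.card_pos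
  let X : (ι ≃ α) → ℝ := fun σ => ∑ b ∈ s, if P b σ then 1 else 0
  have hcount : ∀ (Q : (ι ≃ α) → Prop) [DecidablePred Q],
      ∑ σ : ι ≃ α, (if Q σ then (1 : ℝ) else 0) = M * pr Q := by
    intro Q _
    rw [pr_eq, mul_div_cancel₀ _ hM.ne', Finset.sum_boole]
  have hX1 : ∑ σ, X σ = M * (s.card * f) := by
    simp only [X]
    rw [Finset.sum_comm, Finset.sum_congr rfl fun b hb => by rw [hcount, h1 b hb],
      Finset.sum_const, nsmul_eq_mul]
    ring
  have hX2 : ∑ σ, X σ ^ 2 ≤ M * (s.card * f + s.card ^ 2 * f ^ 2) := by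
    have h3 : ∀ σ, X σ ^ 2 = ∑ b ∈ s, ∑ c ∈ s, if P b σ ∧ P c σ then (1 : ℝ) else 0 := by
      intro σ
      rw [sq, Finset.sum_mul_sum]
      refine Finset.sum_congr rfl fun b _ => Finset.sum_congr rfl fun c _ => ?_
      by_cases hb : P b σ <;> by_cases hc : P c σ <;> simp [hb, hc]
    have h4 : ∀ b ∈ s, ∑ c ∈ s, pr (fun σ => P b σ ∧ P c σ) ≤ f + s.card * f ^ 2 := by
      intro b hb
      rw [← Finset.add_sum_erase _ _ hb]
      refine add_le_add ?_ ?_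
      · rw [← h1 b hb]
        exact pr_mono fun σ h => h.1
      · refine (Finset.sum_le_card_nsmul _ _ (f ^ 2) fun c hc => h2 b hb c
          (Finset.mem_of_mem_erase hc) (Finset.ne_of_mem_erase hc).symm).trans ?_
        rw [nsmul_eq_mul]
        gcongr
        exact Finset.erase_subset _ _
    calc ∑ σ, X σ ^ 2 = ∑ b ∈ s, ∑ c ∈ s, M * pr (fun σ => P b σ ∧ P c σ) := by
          simp only [h3]
          rw [Finset.sum_comm]
          refine Finset.sum_congr rfl fun b _ => ?_
          rw [Finset.sum_comm]
          exact Finset.sum_congr rfl fun c _ => hcount _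
      _ = M * ∑ b ∈ s, ∑ c ∈ s, pr (fun σ => P b σ ∧ P c σ) := by simp only [Finset.mul_sum]
      _ ≤ M * (s.card • (f + s.card * f ^ 2)) := by
          gcongr
          exact Finset.sum_le_card_nsmul _ _ _ h4
      _ = _ := by
          rw [nsmul_eq_mul]
          ring
  have hs0 : (0 : ℝ) < s.card := by exact_mod_cast hs.card_pos
  have h5 : ∑ σ : ι ≃ α, (if ∀ b ∈ s, ¬ P b σ then (1 : ℝ) else 0) * (s.card * f) ^ 2 ≤
      ∑ σ, (X σ - s.card * f) ^ 2 := by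
    refine Finset.sum_le_sum fun σ _ => ?_
    split_ifs with h
    · have : X σ = 0 := Finset.sum_eq_zero fun b hb => if_neg (h b hb)
      rw [this]
      apply le_of_eq
      ring
    · rw [zero_mul]
      positivity
  have h6 : ∑ σ, (X σ - s.card * f) ^ 2 ≤ M * (s.card * f) := by
    have : ∑ σ, (X σ - s.card * f) ^ 2 =
        ∑ σ, X σ ^ 2 - 2 * (s.card * f) * ∑ σ, X σ + M * (s.card * f) ^ 2 := by
      rw [Finset.mul_sum, ← Finset.sum_sub_distrib]
      have h7 : M * (s.card * f) ^ 2 = ∑ _σ : ι ≃ α, ((s.card : ℝ) * f) ^ 2 := by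
        rw [Finset.sum_const, nsmul_eq_mul, Finset.card_univ]
      rw [h7, ← Finset.sum_add_distrib]
      exact Finset.sum_congr rfl fun σ _ => by ring
    rw [this, hX1]
    nlinarith
  rw [← Finset.sum_mul, hcount (fun σ => ∀ b ∈ s, ¬ P b σ)] at h5
  have h8 : M * (pr (fun σ => ∀ b ∈ s, ¬ P b σ) * (s.card * f)) * (s.card * f) ≤
      M * 1 * (s.card * f) := by linarith [h5.trans h6]
  have h9 := le_of_mul_le_mul_left (le_of_mul_le_mul_right h8 (by positivity)) hM
  rwa [← one_div, le_div_iff₀ (by positivity)]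

/-- The probability that all values on `R` lie in `F`. -/
lemma pr_forall_mem_eq (R : Finset ι) (F : Finset α) (hι : Fintype.card ι = Fintype.card α)
    [Nonempty (ι ≃ α)] :
    pr (fun σ : ι ≃ α => ∀ r ∈ R, σ r ∈ F) =
      ∏ j ∈ Finset.range R.card, ((F.card - j : ℕ) : ℝ) / (Fintype.card α - j) := by
  classical
  induction R using Finset.induction_on with
  | empty =>
    have : pr (fun σ : ι ≃ α => True) = 1 := by
      have := pr_not (fun _ : ι ≃ α => False)
      rw [pr_false, sub_zero] at this
      rw [← this]
      exact pr_congr fun σ => by simp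
    rw [Finset.card_empty, Finset.prod_range_zero, ← this]
    exact pr_congr fun σ => by simp
  | insert r R hr ih =>
    obtain ⟨A, hA⟩ : ∃ A : (ι ≃ α) → Prop, A = fun σ => ∀ q ∈ R, σ q ∈ F := ⟨_, rfl⟩
    have hdet : DeterminedOn R A := hA ▸ determinedOn_of_forall fun _ x => x ∈ F
    have h := card_filter_apply_mem hr hdet (B := fun _ => F) (fun _ _ _ => rfl)
    have hlt : R.card < Fintype.card ι := by
      rw [← Finset.card_univ]
      exact Finset.card_lt_card (Finset.ssubset_univ_iff.2 fun h => hr (h ▸ Finset.mem_univ r))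
    have hsub : ∀ σ ∈ Finset.univ.filter A, (F \ R.image σ).card = F.card - R.card := by
      intro σ hσ
      have hσ' := (Finset.mem_filter.1 hσ).2
      rw [hA] at hσ'
      have hsub : R.image σ ⊆ F := Finset.image_subset_iff.2 hσ'
      rw [Finset.card_sdiff_of_subset hsub, Finset.card_image_of_injective _ σ.injective]
    rw [Finset.sum_congr rfl hsub, Finset.sum_const, smul_eq_mul] at h
    have hlt' : (R.card : ℝ) < Fintype.card α := by rw [← hι]; exact_mod_cast hlt
    have h' : ((Fintype.card α : ℝ) - R.card) * (Finset.univ.filter fun σ => A σ ∧ σ r ∈ F).card =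
        (Finset.univ.filter A).card * (F.card - R.card : ℕ) := by
      rw [← hι, ← Nat.cast_sub hlt.le]
      exact_mod_cast h
    have h2 : pr (fun σ : ι ≃ α => ∀ q ∈ insert r R, σ q ∈ F) = pr (fun σ => A σ ∧ σ r ∈ F) :=
      pr_congr fun σ => by
        rw [Finset.forall_mem_insert, hA]
        tauto
    rw [Finset.card_insert_of_notMem hr, Finset.prod_range_succ, ← ih, ← hA, h2, pr_eq, pr_eq,
      div_mul_div_comm, ← h', mul_comm _ (_ - _ : ℝ), mul_div_mul_left]
    exact (sub_pos.2 hlt').ne'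

end SecondMoment

section Uncovered
variable {k n : ℕ} {H : SimpleGraph (Fin k)}

instance : Nonempty (ProcSample H n) := ⟨Fintype.equivOfCardEq card_fin_numCopies⟩

/-- Some vertex is uncovered. -/
lemma pr_forall_covered_le (hk : 0 < k) (hiso : ∀ v, (H.neighborSet v).Nonempty) (hkn : k ≤ n)
    {m : ℕ} {x : ℝ} (hm : 2 * m ≤ numCopies H n)
    (hx : ∀ j < m, k / n * (numCopies H n : ℝ) ≤ x * (numCopies H n - j)) (hx1 : x ≤ 1 / 2) :
    pr (fun ω : ProcSample H n => ¬ ∃ v : Fin n, ∀ p ∈ firstPos (numCopies H n) m,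
      v ∉ verts (ω p)) ≤ (n * (1 - x) ^ m)⁻¹ := by
  classical
  have hn : 0 < n := hk.trans_le hkn
  have hn' : (0 : ℝ) < n := by exact_mod_cast hn
  have hk1 : (1 : ℝ) ≤ k := by exact_mod_cast hk
  have hkn' : (k : ℝ) ≤ n := by exact_mod_cast hkn
  have hN : (0 : ℝ) < numCopies H n := by exact_mod_cast numCopies_pos hkn
  have hcard : Fintype.card (Copy H n) = numCopies H n := by
    rw [← card_fin_numCopies, Fintype.card_fin]
  have hR : (firstPos (numCopies H n) m).card = m := card_firstPos (by omega)
  have hmN : (2 * m : ℝ) ≤ numCopies H n := by exact_mod_cast hm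
  have hlt : ∀ j < m, (0 : ℝ) < numCopies H n - j := by
    intro j hj
    have : (j : ℝ) < m := by exact_mod_cast hj
    linarith
  let F : Fin n → Finset (Copy H n) := fun v => Finset.univ.filter fun c => v ∉ verts c
  set N : ℝ := (numCopies H n : ℝ)
  set d : ℝ := (k : ℝ) / n * N
  have hd : 0 ≤ d := by positivity
  have hdj : ∀ j < m, 2 * d ≤ N - j := by
    intro j hj
    have := hx j hj
    nlinarith [hlt j hj]
  have hF : ∀ v, ((F v).card : ℝ) = N - d := by
    intro v
    have h := Finset.card_filter_add_card_filter_not (s := (Finset.univ : Finset (Copy H n)))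
      (fun c => v ∈ verts c)
    rw [Finset.card_univ, hcard] at h
    have h' := card_copies_mem_real hiso v
    have h'' : ((Finset.univ.filter fun c : Copy H n => v ∈ verts c).card : ℝ) + (F v).card = N := by
      rw [← Nat.cast_add]
      exact congrArg Nat.cast h
    linarith
  have hFF : ∀ u v, u ≠ v → ((F u ∩ F v).card : ℝ) ≤ N - 2 * d + d ^ 2 / N := by
    intro u v huv
    have h := Finset.card_filter_add_card_filter_not (s := F u) (fun c => v ∈ verts c)
    have h2 := Finset.card_filter_add_card_filter_not
      (s := Finset.univ.filter fun c : Copy H n => v ∈ verts c) (fun c => u ∈ verts c)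
    have h3 : ((F u).filter fun c => v ∉ verts c) = F u ∩ F v := by
      ext c
      simp [F]
    have h4 : ((F u).filter fun c => v ∈ verts c) =
        ((Finset.univ.filter fun c : Copy H n => v ∈ verts c).filter fun c => u ∉ verts c) := by
      ext c
      simp [F, and_comm]
    rw [h3, h4] at h
    have h5 : ((Finset.univ.filter fun c : Copy H n => v ∈ verts c).filter fun c => u ∈ verts c) =
        Finset.univ.filter fun c : Copy H n => u ∈ verts c ∧ v ∈ verts c := by
      ext c
      simp [and_comm]
    rw [h5] at h2
    have hle := card_copies_mem_mem_le hk hiso hkn huv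
    have h' := card_copies_mem_real hiso v
    have hFu := hF u
    have hd2 : (k : ℝ) ^ 2 / n ^ 2 * N = d ^ 2 / N := by
      simp only [d]
      field_simp
    have h6 : (((Finset.univ.filter fun c : Copy H n => v ∈ verts c).filter
        fun c => u ∉ verts c).card : ℝ) + (F u ∩ F v).card = (F u).card := by
      rw [← Nat.cast_add]
      exact congrArg Nat.cast h
    have h7 : ((Finset.univ.filter fun c : Copy H n => u ∈ verts c ∧ v ∈ verts c).card : ℝ) +
        ((Finset.univ.filter fun c : Copy H n => v ∈ verts c).filter
        fun c => u ∉ verts c).card = (Finset.univ.filter fun c : Copy H n => v ∈ verts c).card := by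
      rw [← Nat.cast_add]
      exact congrArg Nat.cast h2
    linarith
  let f : ℝ := ∏ j ∈ Finset.range m, (N - d - j) / (N - j)
  have hterm : ∀ j ∈ Finset.range m, 1 - x ≤ (N - d - j) / (N - j) := by
    intro j hj
    have hj' := Finset.mem_range.1 hj
    rw [le_div_iff₀ (hlt j hj')]
    linarith [hx j hj']
  have hfx : (1 - x) ^ m ≤ f := by
    refine le_of_eq_of_le ?_ (Finset.prod_le_prod (fun j _ => ?_) hterm)
    · rw [Finset.prod_const, Finset.card_range]
    · linarith
  have hpow : 0 < (1 - x) ^ m := pow_pos (by linarith) m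
  have key := pr_forall_not_le (ι := Fin (numCopies H n)) (α := Copy H n) Finset.univ
    (fun v ω => ∀ p ∈ firstPos (numCopies H n) m, ω p ∈ F v) (hpow.trans_le hfx)
    ⟨⟨0, hn⟩, Finset.mem_univ _⟩ ?_ ?_
  · rw [Finset.card_univ, Fintype.card_fin] at key
    refine le_trans (pr_mono fun ω h => ?_) (key.trans ?_)
    · intro v _ hv
      exact h ⟨v, fun p hp => (Finset.mem_filter.1 (hv p hp)).2⟩
    · gcongr
  · intro v _
    rw [pr_forall_mem_eq _ _ card_fin_numCopies, hR]
    refine Finset.prod_congr rfl fun j hj => ?_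
    have hj' := Finset.mem_range.1 hj
    have h1 : j ≤ (F v).card := by
      have : (j : ℝ) ≤ (F v).card := by
        rw [hF]
        linarith [hdj j hj']
      exact_mod_cast this
    rw [Nat.cast_sub h1, hF, hcard]
  · intro u _ v _ huv
    have h1 : pr (fun ω : ProcSample H n => (∀ p ∈ firstPos (numCopies H n) m, ω p ∈ F u) ∧
        ∀ p ∈ firstPos (numCopies H n) m, ω p ∈ F v) =
        pr (fun ω : ProcSample H n => ∀ p ∈ firstPos (numCopies H n) m, ω p ∈ F u ∩ F v) :=
      pr_congr fun ω => by
        simp only [Finset.mem_inter]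
        exact ⟨fun h p hp => ⟨h.1 p hp, h.2 p hp⟩, fun h => ⟨fun p hp => (h p hp).1,
          fun p hp => (h p hp).2⟩⟩
    rw [h1, pr_forall_mem_eq _ _ card_fin_numCopies, hR, ← Finset.prod_pow, hcard]
    refine Finset.prod_le_prod (fun j hj => ?_) fun j hj => ?_
    · exact div_nonneg (by positivity) (hlt j (Finset.mem_range.1 hj)).le
    · have hj' := Finset.mem_range.1 hj
      have hpos := hlt j hj'
      have hdd : d ^ 2 / N ≤ d ^ 2 / (N - j) := by
        gcongr
        linarith [(Nat.cast_nonneg j : (0 : ℝ) ≤ j)]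
      have h2 : (((F u ∩ F v).card - j : ℕ) : ℝ) ≤ N - j - 2 * d + d ^ 2 / (N - j) := by
        rcases le_total j (F u ∩ F v).card with h | h
        · rw [Nat.cast_sub h]
          linarith [hFF u v huv]
        · rw [Nat.sub_eq_zero_of_le h, Nat.cast_zero]
          have := hdj j hj'
          have : 0 ≤ d ^ 2 / (N - j) := by positivity
          linarith
      refine (div_le_div_of_nonneg_right h2 hpos.le).trans (le_of_eq ?_)
      have hne := hpos.ne'
      change _ = ((N - d - j) / (N - j)) ^ 2
      field_simp
      ring

end Uncovered

section Light
variable {k n : ℕ} {H : SimpleGraph (Fin k)}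

lemma Chain.congr {ω ω' : ProcSample H n} {ps : List (Fin (numCopies H n))} {u v : Fin n}
    (h : ∀ p ∈ ps, ω p = ω' p) : Chain ω u ps v ↔ Chain ω' u ps v := by
  induction ps generalizing u with
  | nil => rfl
  | cons p ps ih =>
    rw [List.forall_mem_cons] at h
    refine exists_congr fun x => ?_
    rw [h.1, ih h.2]

/-- A fresh copy rarely contains two given vertices. -/
lemma pr_mem_mem_le (hk : 0 < k) (hiso : ∀ v, (H.neighborSet v).Nonempty) (hkn : k ≤ n)
    {u x : Fin n} (hx : x ≠ u) {p : Fin (numCopies H n)} {Q : Finset (Fin (numCopies H n))}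
    {A : ProcSample H n → Prop} (hA : DeterminedOn Q A) (hpQ : p ∉ Q)
    (hN : 2 * Q.card ≤ numCopies H n) :
    pr (fun ω : ProcSample H n => A ω ∧
      ω p ∈ Finset.univ.filter fun c : Copy H n => u ∈ verts c ∧ x ∈ verts c) ≤
      (2 * k ^ 2 / n ^ 2) * pr A := by
  classical
  have hN0 : (0 : ℝ) < numCopies H n := by exact_mod_cast numCopies_pos hkn
  have h := pr_apply_mem_le hpQ hA (B := fun _ =>
    Finset.univ.filter fun c : Copy H n => u ∈ verts c ∧ x ∈ verts c) (fun _ _ _ => rfl)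
    (b := k ^ 2 / n ^ 2 * numCopies H n) (q := numCopies H n / 2)
    (fun _ _ => card_copies_mem_mem_le hk hiso hkn hx.symm)
    (by
      have : (2 * Q.card : ℝ) ≤ numCopies H n := by exact_mod_cast hN
      linarith)
    (by rw [Fintype.card_fin]; linarith)
  refine h.trans (le_of_eq ?_)
  rw [Fintype.card_fin]
  congr 1
  field_simp
  ring

/-- A given list of positions rarely forms a chain between two given vertices. -/
lemma pr_chain_le (hk : 0 < k) (hiso : ∀ v, (H.neighborSet v).Nonempty) (hkn : k ≤ n)
    {v : Fin n} (p : Fin (numCopies H n)) (ps : List (Fin (numCopies H n)))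
    (hnd : (p :: ps).Nodup) {u : Fin n} {Q : Finset (Fin (numCopies H n))}
    {A : ProcSample H n → Prop} (hA : DeterminedOn Q A) (hQ : ∀ q ∈ p :: ps, q ∉ Q)
    (hN : 2 * (Q.card + ps.length) ≤ numCopies H n) :
    pr (fun ω : ProcSample H n => A ω ∧ Chain ω u (p :: ps) v) ≤
      (2 * k ^ 2 / n ^ 2) * (2 * k ^ 2 / n) ^ ps.length * pr A := by
  classical
  have hn0 : (0 : ℝ) < n := by exact_mod_cast (by omega : 0 < n)
  induction ps generalizing p u Q A with
  | nil =>
    have hpQ : p ∉ Q := hQ p List.mem_cons_self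
    rw [List.length_nil, pow_zero, mul_one]
    by_cases hvu : v = u
    · refine le_trans (le_of_eq_of_le (pr_congr fun ω => ?_) (pr_false (α := Copy H n)).le)
        (mul_nonneg (by positivity) (pr_nonneg _))
      simp only [Chain, iff_false]
      rintro ⟨-, x, hx, -, -, rfl⟩
      exact hx hvu
    · refine le_trans (pr_mono fun ω h => ?_) (pr_mem_mem_le hk hiso hkn hvu hA hpQ (by omega))
      obtain ⟨hAω, x, hx, hu, hx', rfl⟩ := h
      exact ⟨hAω, Finset.mem_filter.2 ⟨Finset.mem_univ _, hu, hx'⟩⟩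
  | cons p' ps ih =>
    have hpQ : p ∉ Q := hQ p List.mem_cons_self
    rw [List.length_cons] at hN
    have hx : ∀ x ∈ Finset.univ.filter fun x => x ≠ u,
        pr (fun ω : ProcSample H n => (A ω ∧
          ω p ∈ Finset.univ.filter fun c : Copy H n => u ∈ verts c ∧ x ∈ verts c) ∧
          Chain ω x (p' :: ps) v) ≤
        (2 * k ^ 2 / n ^ 2) * (2 * k ^ 2 / n) ^ ps.length * ((2 * k ^ 2 / n ^ 2) * pr A) := by
      intro x hx
      have hdet : DeterminedOn (insert p Q) fun ω : ProcSample H n => A ω ∧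
          ω p ∈ Finset.univ.filter fun c : Copy H n => u ∈ verts c ∧ x ∈ verts c :=
        (hA.mono (Finset.subset_insert _ _)).and fun ω ω' h => by
          rw [h p (Finset.mem_insert_self _ _)]
      have hnot : ∀ q ∈ p' :: ps, q ∉ insert p Q := by
        intro q hq hmem
        rcases Finset.mem_insert.1 hmem with rfl | h
        · exact (List.nodup_cons.1 hnd).1 hq
        · exact hQ q (List.mem_cons_of_mem _ hq) h
      have hN' : 2 * ((insert p Q).card + ps.length) ≤ numCopies H n := by
        rw [Finset.card_insert_of_notMem hpQ]
        omega
      refine (ih p' (List.nodup_cons.1 hnd).2 hdet hnot hN').trans ?_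
      gcongr
      exact pr_mem_mem_le hk hiso hkn (Finset.mem_filter.1 hx).2 hA hpQ (by omega)
    refine le_trans (pr_mono fun ω h => ?_) ((pr_exists_le _ _).trans
      ((Finset.sum_le_card_nsmul _ _ _ hx).trans ?_))
    · obtain ⟨hAω, x, hx, hu, hx', hc⟩ := h
      exact ⟨x, Finset.mem_filter.2 ⟨Finset.mem_univ _, hx⟩,
        ⟨hAω, Finset.mem_filter.2 ⟨Finset.mem_univ _, hu, hx'⟩⟩, hc⟩
    · have hc : ((Finset.univ.filter fun x : Fin n => x ≠ u).card : ℝ) ≤ n := by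
        have := Finset.card_filter_le (Finset.univ : Finset (Fin n)) fun x => x ≠ u
        rw [Finset.card_univ, Fintype.card_fin] at this
        exact_mod_cast this
      rw [nsmul_eq_mul, List.length_cons, pow_succ (_ / _ : ℝ)]
      have h0 := pr_nonneg A
      refine (mul_le_mul_of_nonneg_right hc (by positivity)).trans (le_of_eq ?_)
      generalize (2 * (k : ℝ) ^ 2 / n) ^ ps.length = y
      field_simp

/-- Two vertices are rarely joined by a given chain while the union of their copies is small. -/
lemma pr_chain_light_le (hk : 0 < k) (hiso : ∀ v, (H.neighborSet v).Nonempty) (hkn : k ≤ n)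
    {u v : Fin n} (huv : u ≠ v) (p : Fin (numCopies H n)) (ps : List (Fin (numCopies H n)))
    (hnd : (p :: ps).Nodup) (hlen : ps.length ≤ 3) {m d : ℕ} {K y : ℝ} (hK : 1 ≤ K)
    (hmK : m * (4 * k / n) ≤ K) (hN : 2 * (2 * d + 4) ≤ numCopies H n) (hmN : m ≤ numCopies H n)
    (hy0 : 0 ≤ y) (hy1 : y ≤ 1)
    (hy : y * numCopies H n ≤ (2 * k / n - k ^ 2 / n ^ 2) * numCopies H n - (2 * d + 4)) :
    pr (fun ω : ProcSample H n => IsLight ω m d u ∧ IsLight ω m d v ∧ Chain ω u (p :: ps) v) ≤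
      (2 * k ^ 2 / n ^ 2) * (2 * k ^ 2 / n) ^ ps.length *
        (2 * d * (K ^ (2 * d) * Real.exp (-(y * (m - (2 * d + 4)))))) := by
  classical
  have hn0 : (0 : ℝ) < n := by exact_mod_cast (by omega : 0 < n)
  have hN0 : (0 : ℝ) < numCopies H n := by exact_mod_cast numCopies_pos hkn
  let S := firstPos (numCopies H n) m
  let L := (p :: ps).toFinset
  have hL : L.card ≤ 4 := (List.toFinset_card_le _).trans (by rw [List.length_cons]; omega)
  let B : Finset (Copy H n) := Finset.univ.filter fun c => u ∈ verts c ∨ v ∈ verts c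
  set β : ℝ := (2 * k ^ 2 / n ^ 2) * (2 * k ^ 2 / n) ^ ps.length with hβ
  set e : ℝ := Real.exp (-(y * (m - (2 * d + 4)))) with he
  have hBu : ((Finset.univ.filter fun c : Copy H n => u ∈ verts c).card : ℝ) +
      (Finset.univ.filter fun c : Copy H n => v ∈ verts c).card =
      B.card + (Finset.univ.filter fun c : Copy H n => u ∈ verts c ∧ v ∈ verts c).card := by
    have := Finset.card_union_add_card_inter (Finset.univ.filter fun c : Copy H n => u ∈ verts c)
      (Finset.univ.filter fun c : Copy H n => v ∈ verts c)
    rw [← Finset.filter_or, ← Finset.filter_and] at this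
    exact_mod_cast this.symm
  rw [card_copies_mem_real hiso, card_copies_mem_real hiso] at hBu
  have hB1 : (B.card : ℝ) ≤ 2 * k / n * numCopies H n := by
    have : (0 : ℝ) ≤ (Finset.univ.filter fun c : Copy H n => u ∈ verts c ∧ v ∈ verts c).card :=
      Nat.cast_nonneg _
    have h2 : (2 * k / n * numCopies H n : ℝ) = k / n * numCopies H n + k / n * numCopies H n := by
      ring
    linarith
  have hB2 : y * numCopies H n + (2 * d + 4) ≤ B.card := by
    have := card_copies_mem_mem_le hk hiso hkn huv
    have h2 : ((2 * k / n - k ^ 2 / n ^ 2) * numCopies H n : ℝ) =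
      k / n * numCopies H n + k / n * numCopies H n - k ^ 2 / n ^ 2 * numCopies H n := by ring
    linarith
  have hQ : ∀ j ∈ Finset.range (2 * d), ∀ Q ∈ Finset.powersetCard j (S \ L),
      pr (fun ω : ProcSample H n => (Chain ω u (p :: ps) v ∧ ∀ q ∈ Q, ω q ∈ B) ∧
        ∀ q ∈ (S \ L) \ Q, ω q ∉ B) ≤ e * ((4 * k / n) ^ j * β) := by
    intro j hj Q hQ
    obtain ⟨hQS, hQj⟩ := Finset.mem_powersetCard.1 hQ
    have hj' := Finset.mem_range.1 hj
    have hdet : DeterminedOn L fun ω : ProcSample H n => Chain ω u (p :: ps) v :=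
      fun ω ω' h => propext (Chain.congr fun q hq => h q (List.mem_toFinset.2 hq))
    have hLQ : Disjoint L Q := Finset.disjoint_of_subset_right hQS Finset.disjoint_sdiff
    have hdet2 : DeterminedOn (L ∪ Q) fun ω : ProcSample H n =>
        Chain ω u (p :: ps) v ∧ ∀ q ∈ Q, ω q ∈ B :=
      (hdet.mono Finset.subset_union_left).and
        ((determinedOn_of_forall fun _ c => c ∈ B).mono Finset.subset_union_right)
    have hc : (L ∪ Q).card ≤ 2 * d + 4 := (Finset.card_union_le _ _).trans (by omega)
    have h1 : pr (fun ω : ProcSample H n => Chain ω u (p :: ps) v) ≤ β := by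
      have := pr_chain_le hk hiso hkn (v := v) p ps hnd (u := u) (determinedOn_empty_const True)
        (fun q _ => Finset.notMem_empty q) (by rw [Finset.card_empty]; omega)
      simp only [true_and] at this
      exact this.trans (mul_le_of_le_one_right (by positivity) (pr_le_one _))
    have hN' : 2 * ((2 * d + 4 : ℕ) : ℝ) ≤ numCopies H n := by exact_mod_cast hN
    have h2 := pr_forall_mem_le hLQ hdet B hB1 (q := numCopies H n / 2)
      (by
        have : ((L.card : ℝ) + Q.card) ≤ (2 * d + 4 : ℕ) := by
          exact_mod_cast (by omega : L.card + Q.card ≤ 2 * d + 4)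
        linarith)
      (by rw [Fintype.card_fin]; linarith)
    have h3 := pr_forall_notMem_le (R := (S \ L) \ Q) (B := fun _ => B)
      (b := y * numCopies H n) (Finset.disjoint_union_left.2
        ⟨Finset.disjoint_of_subset_right Finset.sdiff_subset Finset.disjoint_sdiff,
          Finset.disjoint_sdiff⟩) hdet2 (fun _ _ _ => rfl) (fun ω _ => by
        have h4 := Finset.le_card_sdiff ((L ∪ Q).image ω) B
        have h5 : ((L ∪ Q).image ω).card ≤ 2 * d + 4 := Finset.card_image_le.trans hc
        have h6 : (B.card : ℝ) ≤ (B \ (L ∪ Q).image ω).card + (2 * d + 4) := by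
          exact_mod_cast (by omega : B.card ≤ (B \ (L ∪ Q).image ω).card + (2 * d + 4))
        linarith)
    have h7 : (2 * k / n * numCopies H n : ℝ) /
        (Fintype.card (Fin (numCopies H n)) - numCopies H n / 2) = 4 * k / n := by
      rw [Fintype.card_fin]
      field_simp
      ring
    rw [h7, hQj] at h2
    rw [Fintype.card_fin, mul_div_assoc, div_self hN0.ne', mul_one] at h3
    refine h3.trans (mul_le_mul ?_ (h2.trans ?_) (pr_nonneg _) (Real.exp_nonneg _))
    · refine (one_sub_pow_le_exp le_rfl hy1 _).trans (Real.exp_le_exp.2 ?_)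
      have h8 : m ≤ ((S \ L) \ Q).card + (2 * d + 4) := by
        have h9 := Finset.le_card_sdiff L S
        have h10 := Finset.le_card_sdiff Q (S \ L)
        have h11 : S.card = m := card_firstPos hmN
        omega
      have h8' : (m : ℝ) ≤ ((S \ L) \ Q).card + (2 * d + 4) := by exact_mod_cast h8
      have := mul_le_mul_of_nonneg_left h8' hy0
      linarith
    · gcongr
  refine (pr_mono (P' := fun ω => ∃ j ∈ Finset.range (2 * d),
    ∃ Q ∈ Finset.powersetCard j (S \ L), (Chain ω u (p :: ps) v ∧ ∀ q ∈ Q, ω q ∈ B) ∧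
        ∀ q ∈ (S \ L) \ Q, ω q ∉ B) fun ω h => ?_).trans ((pr_exists_le _ _).trans
    ((Finset.sum_le_card_nsmul _ _ (K ^ (2 * d) * (e * β)) fun j hj =>
      (pr_exists_le _ _).trans ((Finset.sum_le_card_nsmul _ _ _ (hQ j hj)).trans ?_)).trans ?_))
  · obtain ⟨hu, hv, hc⟩ := h
    have hcard : ((S \ L).filter fun q => ω q ∈ B).card < 2 * d := by
      have h1 : ((S \ L).filter fun q => ω q ∈ B) ⊆
          (S.filter fun q => u ∈ verts (ω q)) ∪ (S.filter fun q => v ∈ verts (ω q)) := by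
        intro q hq
        obtain ⟨hq, hqB⟩ := Finset.mem_filter.1 hq
        have hqS := (Finset.mem_sdiff.1 hq).1
        rcases (Finset.mem_filter.1 hqB).2 with h | h
        · exact Finset.mem_union_left _ (Finset.mem_filter.2 ⟨hqS, h⟩)
        · exact Finset.mem_union_right _ (Finset.mem_filter.2 ⟨hqS, h⟩)
      have h2 := (Finset.card_le_card h1).trans (Finset.card_union_le _ _)
      have hu' : (S.filter fun q => u ∈ verts (ω q)).card < d := hu
      have hv' : (S.filter fun q => v ∈ verts (ω q)).card < d := hv
      omega
    refine ⟨_, Finset.mem_range.2 hcard, _, Finset.mem_powersetCard.2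
      ⟨Finset.filter_subset _ _, rfl⟩, ⟨hc, fun q hq => (Finset.mem_filter.1 hq).2⟩,
      fun q hq hqB => ?_⟩
    obtain ⟨hq, hq'⟩ := Finset.mem_sdiff.1 hq
    exact hq' (Finset.mem_filter.2 ⟨hq, hqB⟩)
  · have hj' := Finset.mem_range.1 hj
    rw [nsmul_eq_mul, Finset.card_powersetCard]
    have h1 : ((S \ L).card.choose j : ℝ) ≤ (m : ℝ) ^ j := by
      refine le_trans ?_ (pow_le_pow_left₀ (Nat.cast_nonneg _) (a := ((S \ L).card : ℝ)) ?_ j)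
      · exact_mod_cast Nat.choose_le_pow _ _
      · exact_mod_cast (Finset.card_le_card Finset.sdiff_subset).trans (card_firstPos_le _ _)
    calc ((S \ L).card.choose j : ℝ) * (e * ((4 * k / n) ^ j * β))
        ≤ (m : ℝ) ^ j * (e * ((4 * k / n) ^ j * β)) := by gcongr
      _ = (m * (4 * k / n)) ^ j * (e * β) := by
          rw [mul_pow]
          ring
      _ ≤ K ^ j * (e * β) := by gcongr
      _ ≤ _ := by gcongr
  · rw [nsmul_eq_mul, Finset.card_range, Nat.cast_mul, Nat.cast_two]
    apply le_of_eq
    ring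

/-- Light vertices are rarely close to each other. -/
lemma pr_not_lightFar_le (hk : 0 < k) (hiso : ∀ v, (H.neighborSet v).Nonempty) (hkn : k ≤ n)
    {m m' d : ℕ} {K y : ℝ} (hK : 1 ≤ K) (hmK : m * (4 * k / n) ≤ K)
    (hmK' : m' * (2 * k ^ 2 / n) ≤ K) (hN : 2 * (2 * d + 4) ≤ numCopies H n)
    (hmN : m ≤ numCopies H n) (hy0 : 0 ≤ y) (hy1 : y ≤ 1)
    (hy : y * numCopies H n ≤ (2 * k / n - k ^ 2 / n ^ 2) * numCopies H n - (2 * d + 4)) :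
    pr (fun ω : ProcSample H n => ¬ LightFar ω m m' d) ≤
      4 * n * K ^ 4 * (2 * d * (K ^ (2 * d) * Real.exp (-(y * (m - (2 * d + 4)))))) := by
  classical
  have hn0 : (0 : ℝ) < n := by exact_mod_cast (by omega : 0 < n)
  set C : ℝ := 2 * d * (K ^ (2 * d) * Real.exp (-(y * (m - (2 * d + 4))))) with hC
  have hC0 : 0 ≤ C := by positivity
  let T := firstPos (numCopies H n) m'
  have hlist : ∀ e : Fin n × Fin n, ∀ r ∈ Finset.range 4,
      ∀ f ∈ Fintype.piFinset fun _ : Fin (r + 1) => T,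
      pr (fun ω : ProcSample H n => e.1 ≠ e.2 ∧ (List.ofFn f).Nodup ∧ IsLight ω m d e.1 ∧
        IsLight ω m d e.2 ∧ Chain ω e.1 (List.ofFn f) e.2) ≤
      (2 * k ^ 2 / n ^ 2) * (2 * k ^ 2 / n) ^ r * C := by
    intro e r hr f hf
    by_cases he : e.1 ≠ e.2 ∧ (List.ofFn f).Nodup
    · have hr' := Finset.mem_range.1 hr
      have hnd := he.2
      rw [List.ofFn_succ] at hnd
      have := pr_chain_light_le hk hiso hkn he.1 _ _ hnd (by rw [List.length_ofFn]; omega) hK hmK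
        hN hmN hy0 hy1 hy
      rw [List.length_ofFn] at this
      refine (pr_mono fun ω h => ?_).trans this
      rw [← List.ofFn_succ]
      exact h.2.2
    · refine le_trans (le_of_eq_of_le (pr_congr fun ω => ?_) (pr_false (α := Copy H n)).le)
        (by positivity)
      simp only [iff_false]
      exact fun h => he ⟨h.1, h.2.1⟩
  have hr : ∀ e : Fin n × Fin n, ∀ r ∈ Finset.range 4,
      pr (fun ω : ProcSample H n => ∃ f ∈ Fintype.piFinset fun _ : Fin (r + 1) => T,
        e.1 ≠ e.2 ∧ (List.ofFn f).Nodup ∧ IsLight ω m d e.1 ∧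
        IsLight ω m d e.2 ∧ Chain ω e.1 (List.ofFn f) e.2) ≤ K ^ 4 / n * C := by
    intro e r hr
    have hr' := Finset.mem_range.1 hr
    refine (pr_exists_le _ _).trans ((Finset.sum_le_card_nsmul _ _ _ (hlist e r hr)).trans ?_)
    rw [nsmul_eq_mul, Fintype.card_piFinset_const]
    have hT : (T.card : ℝ) ≤ m' := by exact_mod_cast card_firstPos_le _ _
    calc ((T.card ^ (r + 1) : ℕ) : ℝ) * (2 * k ^ 2 / n ^ 2 * (2 * k ^ 2 / n) ^ r * C)
        ≤ (m' : ℝ) ^ (r + 1) * (2 * k ^ 2 / n ^ 2 * (2 * k ^ 2 / n) ^ r * C) := by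
          push_cast
          gcongr
      _ = (m' * (2 * k ^ 2 / n)) ^ (r + 1) / n * C := by
          rw [mul_pow, pow_succ (2 * (k : ℝ) ^ 2 / n)]
          field_simp
      _ ≤ K ^ (r + 1) / n * C := by gcongr
      _ ≤ _ := by
          gcongr
          omega
  refine (pr_mono (P' := fun ω => ∃ e ∈ (Finset.univ : Finset (Fin n × Fin n)),
    ∃ r ∈ Finset.range 4, ∃ f ∈ Fintype.piFinset fun _ : Fin (r + 1) => T,
        e.1 ≠ e.2 ∧ (List.ofFn f).Nodup ∧ IsLight ω m d e.1 ∧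
        IsLight ω m d e.2 ∧ Chain ω e.1 (List.ofFn f) e.2) fun ω h => ?_).trans
    ((pr_exists_le _ _).trans ((Finset.sum_le_card_nsmul _ _ _ fun e _ =>
      (pr_exists_le _ _).trans (Finset.sum_le_card_nsmul _ _ _ (hr e))).trans ?_))
  · unfold LightFar at h
    push Not at h
    obtain ⟨u, v, huv, hu, hv, ps, hnd, hT, hlen, hc⟩ := h
    cases ps with
    | nil => exact absurd hc huv
    | cons p ps =>
      have hofn : List.ofFn (p :: ps).get = p :: ps := List.ofFn_get _
      refine ⟨(u, v), Finset.mem_univ _, ps.length, Finset.mem_range.2 ?_, (p :: ps).get,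
        Fintype.mem_piFinset.2 fun i => hT _ (List.get_mem _ _), huv, ?_⟩
      · rw [List.length_cons] at hlen
        omega
      · change (List.ofFn (p :: ps).get).Nodup ∧ _ ∧ _ ∧ Chain ω u (List.ofFn (p :: ps).get) v
        rw [hofn]
        exact ⟨hnd, hu, hv, hc⟩
  · rw [nsmul_eq_mul, nsmul_eq_mul, Finset.card_univ, Fintype.card_prod, Fintype.card_fin,
      Finset.card_range]
    push_cast
    apply le_of_eq
    field_simp

end Light

section Asymptotics
variable {k n : ℕ} {H : SimpleGraph (Fin k)}

/-- A number of copies after which some vertex is still uncovered. -/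
noncomputable def lowerTime (k n : ℕ) : ℕ := ⌊3 / 4 * n * Real.log n / k⌋₊

/-- A number of copies after which all degrees are at least two. -/
noncomputable def upperTime (n : ℕ) : ℕ := n * ⌈6 * Real.log n⌉₊

/-- A number of copies after which large sets expand. -/
noncomputable def expandTime (n : ℕ) : ℕ := n * ⌊√(Real.log n)⌋₊

lemma lt_lowerTime (k n : ℕ) : 3 / 4 * n * Real.log n / k < lowerTime k n + 1 :=
  Nat.lt_floor_add_one _

lemma sq_le_numCopies (hk : 0 < k) (hiso : ∀ v, (H.neighborSet v).Nonempty) (hkn : k ≤ n)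
    (hn : 2 ≤ n) : (n : ℝ) ^ 2 ≤ 2 * k ^ 2 * numCopies H n := by
  have h := le_numCopies hk hiso hkn
  have h1 : n ^ 2 ≤ 2 * (n * (n - 1)) := by
    obtain ⟨j, rfl⟩ := Nat.exists_eq_add_of_le hn
    rw [show 2 + j - 1 = 1 + j by omega]
    nlinarith
  have h2 : n ^ 2 ≤ 2 * k ^ 2 * numCopies H n := by
    rw [mul_assoc]
    omega
  exact_mod_cast h2

/-- `n` is large compared with `k`. -/
structure IsLarge (k n : ℕ) : Prop where
  pos : 0 < k
  one_le_log : 1 ≤ Real.log n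
  mul_sq_le : 1000 * k ^ 2 ≤ n
  mul_log_le : 28 * k ^ 2 * Real.log n ≤ n

namespace IsLarge

lemma k_pos (h : IsLarge k n) : (0 : ℝ) < k := by exact_mod_cast h.pos

lemma mul_le (h : IsLarge k n) : 1000 * k ≤ n := by
  have := h.mul_sq_le
  have := h.pos
  nlinarith

lemma le (h : IsLarge k n) : 1000 ≤ n := by
  have := h.mul_le
  have := h.pos
  omega

lemma n_pos (h : IsLarge k n) : (0 : ℝ) < n := by
  have := h.le
  exact_mod_cast (by omega : 0 < n)

lemma exp_log (h : IsLarge k n) : Real.exp (Real.log n) = n := Real.exp_log h.n_pos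

lemma upperTime_le (h : IsLarge k n) : (upperTime n : ℝ) ≤ n * (7 * Real.log n) := by
  have h1 := Nat.ceil_lt_add_one (a := 6 * Real.log n) (by linarith [h.one_le_log])
  have := h.n_pos
  have := h.one_le_log
  rw [upperTime, Nat.cast_mul]
  gcongr
  linarith

lemma lowerTime_le (h : IsLarge k n) : (lowerTime k n : ℝ) ≤ 3 / 4 * n * Real.log n / k := by
  have := h.n_pos
  have := h.one_le_log
  exact Nat.floor_le (by positivity)

lemma two_mul_upperTime_le (h : IsLarge k n) (hiso : ∀ v, (H.neighborSet v).Nonempty) :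
    2 * upperTime n ≤ numCopies H n := by
  have h1 := sq_le_numCopies (n := n) h.pos hiso (by have := h.mul_le; omega) (by have := h.le; omega)
  have h2 := h.upperTime_le
  have h3 := h.mul_log_le
  have hn := h.n_pos
  have hk := h.k_pos
  have : (2 * upperTime n : ℝ) ≤ numCopies H n := by
    have h4 : (2 * k ^ 2 : ℝ) * (2 * upperTime n) ≤ 2 * k ^ 2 * numCopies H n := by
      calc (2 * k ^ 2 : ℝ) * (2 * upperTime n) ≤ 2 * k ^ 2 * (2 * (n * (7 * Real.log n))) := by
            gcongr
        _ = n * (28 * k ^ 2 * Real.log n) := by ring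
        _ ≤ n * n := by gcongr
        _ ≤ _ := by linarith
    exact le_of_mul_le_mul_left h4 (by positivity)
  exact_mod_cast this

lemma mul_lowerTime_le (h : IsLarge k n) (hiso : ∀ v, (H.neighborSet v).Nonempty) :
    17 * lowerTime k n ≤ numCopies H n := by
  have h1 := sq_le_numCopies (n := n) h.pos hiso (by have := h.mul_le; omega) (by have := h.le; omega)
  have h2 := h.lowerTime_le
  have h3 := h.mul_log_le
  have hn := h.n_pos
  have hk := h.k_pos
  have hk1 : (1 : ℝ) ≤ k := by exact_mod_cast h.pos
  have hl := h.one_le_log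
  have : (17 * lowerTime k n : ℝ) ≤ numCopies H n := by
    have h4 : (2 * k ^ 2 : ℝ) * (17 * lowerTime k n) ≤ 2 * k ^ 2 * numCopies H n := by
      calc (2 * k ^ 2 : ℝ) * (17 * lowerTime k n)
          ≤ 2 * k ^ 2 * (17 * (3 / 4 * n * Real.log n / k)) := by gcongr
        _ ≤ 2 * k ^ 2 * (17 * (3 / 4 * n * Real.log n / 1)) := by gcongr
        _ = n * (51 / 2 * k ^ 2 * Real.log n) := by ring
        _ ≤ n * (28 * k ^ 2 * Real.log n) := by
            gcongr
            norm_num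
        _ ≤ n * n := by gcongr
        _ ≤ _ := by linarith
    exact le_of_mul_le_mul_left h4 (by positivity)
  exact_mod_cast this

/-- Degrees become at least two. -/
lemma pr_degree_le (h : IsLarge k n) (hiso : ∀ v, (H.neighborSet v).Nonempty) :
    pr (fun ω : ProcSample H n =>
      ¬ ∀ v, 2 ≤ ((procGraph ω (upperTime n)).neighborSet v).ncard) ≤
      Real.exp (-Real.log n) := by
  have hu := h.two_mul_upperTime_le hiso
  refine (pr_not_two_le_degree_le h.pos hiso (by have := h.mul_le; omega) (by omega)).trans ?_
  have hn := h.n_pos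
  have h1 : (n : ℝ) ^ 2 = Real.exp (2 * Real.log n) := by
    rw [two_mul, Real.exp_add, h.exp_log, sq]
  rw [h1, ← Real.exp_add, Real.exp_le_exp, upperTime, Nat.cast_mul]
  have h2 := Nat.le_ceil (6 * Real.log n)
  have h3 : 1 / (2 * n) * (n * (⌈6 * Real.log n⌉₊ : ℝ)) = ⌈6 * Real.log n⌉₊ / 2 := by field_simp
  rw [h3]
  linarith

lemma exp_le_one_sub {x : ℝ} (hx : x < 1) : Real.exp (-(x / (1 - x))) ≤ 1 - x := by
  have h1 : 0 < 1 - x := by linarith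
  rw [Real.exp_neg, inv_le_comm₀ (Real.exp_pos _) h1]
  have h2 := Real.add_one_le_exp (x / (1 - x))
  have h3 : (1 - x)⁻¹ = x / (1 - x) + 1 := by
    field_simp
    ring
  linarith

/-- Some vertex is still uncovered. -/
lemma pr_covered_le (h : IsLarge k n) (hiso : ∀ v, (H.neighborSet v).Nonempty) :
    pr (fun ω : ProcSample H n => ¬ ∃ v : Fin n, ∀ p ∈ firstPos (numCopies H n) (lowerTime k n),
      v ∉ verts (ω p)) ≤ Real.exp (-(3 / 16 * Real.log n)) := by
  have hm := h.mul_lowerTime_le hiso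
  have hn := h.n_pos
  have hk := h.k_pos
  have hl := h.one_le_log
  have hm' : (17 * lowerTime k n : ℝ) ≤ numCopies H n := by exact_mod_cast hm
  have hmul : (1000 * k : ℝ) ≤ n := by exact_mod_cast h.mul_le
  have hkn : (k : ℝ) / n ≤ 1 / 1000 := by
    rw [div_le_div_iff₀ hn (by norm_num)]
    linarith
  have hx52 : 17 / 16 * ((k : ℝ) / n) ≤ 1 / 52 := by linarith
  refine (pr_forall_covered_le h.pos hiso (by have := h.mul_le; omega) (x := 17 / 16 * (k / n))
    (by omega) (fun j hj => ?_) (by linarith)).trans ?_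
  · have hj' : (j : ℝ) ≤ lowerTime k n := by exact_mod_cast hj.le
    have h1 : (numCopies H n : ℝ) ≤ 17 / 16 * (numCopies H n - j) := by linarith
    calc (k : ℝ) / n * numCopies H n ≤ k / n * (17 / 16 * (numCopies H n - j)) := by gcongr
      _ = _ := by ring
  · set x : ℝ := 17 / 16 * ((k : ℝ) / n) with hx
    have hx0 : 0 < x := by positivity
    have h1 : Real.exp (-(52 / 51 * x)) ≤ 1 - x := by
      refine le_trans (Real.exp_le_exp.2 (neg_le_neg ?_)) (exp_le_one_sub (by linarith))
      rw [div_le_iff₀ (by linarith)]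
      nlinarith
    have h2 : x * lowerTime k n ≤ 51 / 64 * Real.log n := by
      calc x * lowerTime k n ≤ x * (3 / 4 * n * Real.log n / k) := by
            gcongr
            exact h.lowerTime_le
        _ = _ := by
            rw [hx]
            field_simp
            norm_num
    rw [Real.exp_neg]
    refine inv_anti₀ (Real.exp_pos _) ?_
    calc Real.exp (3 / 16 * Real.log n)
        ≤ Real.exp (Real.log n + lowerTime k n * -(52 / 51 * x)) := by
          rw [Real.exp_le_exp]
          linarith
      _ = n * Real.exp (-(52 / 51 * x)) ^ lowerTime k n := by
          rw [Real.exp_add, h.exp_log, Real.exp_nat_mul]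
      _ ≤ _ := by gcongr

end IsLarge

end Asymptotics

section Asymptotics
variable {k n : ℕ} {H : SimpleGraph (Fin k)}

/-- The size below which sets of vertices are sparsely covered. -/
noncomputable def smallSize (n : ℕ) : ℕ :=
  ⌊Real.exp (-(⌊√(Real.log n)⌋₊ / 16)) * n⌋₊

/-- The failure probability of `LightFar`, as a function of `log n`. -/
noncomputable def lightError (k : ℕ) (l : ℝ) : ℝ :=
  4 * (28 * k ^ 2 * l) ^ 4 * (24 * k * (28 * k ^ 2 * l) ^ (24 * k)) * Real.exp (1 - 13 / 32 * l)

/-- The failure probability of `SmallSparse`, as a function of `log n`. -/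
noncomputable def sparseError (k : ℕ) (l : ℝ) : ℝ :=
  Real.exp 3 * k ^ 4 * (7 * l) ^ 2 * (6 * Real.exp (-((√l - 1) / 16)))

/-- The failure probability of `LargeExpands`, as a function of `log n`. -/
noncomputable def expandError (l : ℝ) : ℝ := Real.exp (3 - (√l - 1) / 16)

namespace IsLarge

/-- Light vertices are far apart. -/
lemma pr_lightFar_le (h : IsLarge k n) (hiso : ∀ v, (H.neighborSet v).Nonempty) :
    pr (fun ω : ProcSample H n => ¬ LightFar ω (lowerTime k n) (upperTime n) (12 * k)) ≤
      lightError k (Real.log n) := by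
  have hm := h.mul_lowerTime_le hiso
  have hn := h.n_pos
  have hk := h.k_pos
  have hk1 : (1 : ℝ) ≤ k := by exact_mod_cast h.pos
  have hl := h.one_le_log
  have hkk : (1 : ℝ) ≤ (k : ℝ) ^ 2 := one_le_pow₀ hk1
  have hmul : (1000 * k : ℝ) ≤ n := by exact_mod_cast h.mul_le
  have hmul2 : (1000 * k ^ 2 : ℝ) ≤ n := by exact_mod_cast h.mul_sq_le
  have hkn : (k : ℝ) / n ≤ 1 / 1000 := by
    rw [div_le_div_iff₀ hn (by norm_num)]
    linarith
  have hkn0 : 0 < (k : ℝ) / n := by positivity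
  have hN := sq_le_numCopies (n := n) h.pos hiso (by have := h.mul_le; omega)
    (by have := h.le; omega)
  have hqN : (500 * k : ℝ) ≤ k / n * numCopies H n := by
    have h1 : (500 * k : ℝ) ≤ k / n * (n ^ 2 / (2 * k ^ 2)) := by
      have : (k : ℝ) / n * (n ^ 2 / (2 * k ^ 2)) = n / (2 * k) := by field_simp
      rw [this, le_div_iff₀ (by positivity)]
      linarith
    refine h1.trans ?_
    gcongr
    rw [div_le_iff₀ (by positivity)]
    linarith
  set l := Real.log n
  have hkl : l ≤ k ^ 2 * l := le_mul_of_one_le_left (by linarith) hkk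
  have hy : 15 / 8 * ((k : ℝ) / n) * numCopies H n ≤
      (2 * k / n - k ^ 2 / n ^ 2) * numCopies H n - (2 * ((12 * k : ℕ) : ℝ) + 4) := by
    have h2 : (k : ℝ) ^ 2 / n ^ 2 * numCopies H n = k / n * (k / n * numCopies H n) := by ring
    have h3 : (k : ℝ) / n * (k / n * numCopies H n) ≤ 1 / 1000 * (k / n * numCopies H n) := by
      gcongr
    have h4 : (2 * k / n - k ^ 2 / n ^ 2 : ℝ) * numCopies H n =
      2 * (k / n * numCopies H n) - k ^ 2 / n ^ 2 * numCopies H n := by ring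
    push_cast
    linarith
  have hNn : 2 * (2 * (12 * k) + 4) ≤ numCopies H n := by
    have h2 : (k : ℝ) / n * numCopies H n ≤ 1 / 1000 * numCopies H n := by gcongr
    have : (2 * (2 * (12 * k) + 4) : ℝ) ≤ numCopies H n := by linarith
    exact_mod_cast this
  refine (pr_not_lightFar_le h.pos hiso (by have := h.mul_le; omega) (K := 28 * k ^ 2 * l)
    (y := 15 / 8 * (k / n)) (by linarith) ?_ ?_ hNn (by omega) (by positivity) (by linarith)
    hy).trans ?_
  · calc (lowerTime k n : ℝ) * (4 * k / n) ≤ (3 / 4 * n * l / k) * (4 * k / n) := by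
          gcongr
          exact h.lowerTime_le
      _ = 3 * l := by
          field_simp
      _ ≤ _ := by linarith
  · calc (upperTime n : ℝ) * (2 * k ^ 2 / n) ≤ n * (7 * l) * (2 * k ^ 2 / n) := by
          gcongr
          exact h.upperTime_le
      _ = 14 * (k ^ 2 * l) := by
          field_simp
          norm_num
      _ ≤ _ := by linarith
  · have h5 : (n : ℝ) * Real.exp (-(15 / 8 * (k / n) *
        (lowerTime k n - (2 * ((12 * k : ℕ) : ℝ) + 4)))) ≤ Real.exp (1 - 13 / 32 * l) := by
      nth_rewrite 1 [← h.exp_log]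
      rw [← Real.exp_add, Real.exp_le_exp]
      have h6 := lt_lowerTime k n
      have h7 : 15 / 8 * ((k : ℝ) / n) * (3 / 4 * n * l / k) = 45 / 32 * l := by
        field_simp
        norm_num
      have h8 : 15 / 8 * ((k : ℝ) / n) * (3 / 4 * n * l / k) ≤
          15 / 8 * ((k : ℝ) / n) * (lowerTime k n + 1) := by gcongr
      have h9 : 15 / 8 * ((k : ℝ) / n) * (24 * k + 5) ≤ 1 := by
        have h10 : 15 / 8 * ((k : ℝ) / n) * (24 * k + 5) = (45 * k ^ 2 + 75 / 8 * k) / n := by ring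
        rw [h10, div_le_one hn]
        nlinarith
      push_cast
      linarith
    calc _ = 4 * (28 * k ^ 2 * l) ^ 4 * (24 * k * (28 * k ^ 2 * l) ^ (24 * k)) *
          (n * Real.exp (-(15 / 8 * (k / n) *
            (lowerTime k n - (2 * ((12 * k : ℕ) : ℝ) + 4))))) := by
          rw [show 2 * (12 * k) = 24 * k by ring]
          push_cast
          ring
      _ ≤ _ := by
          rw [lightError]
          gcongr

/-- Small sets are sparsely covered. -/
lemma pr_smallSparse_le (h : IsLarge k n) (hiso : ∀ v, (H.neighborSet v).Nonempty)
    (he : sparseError k (Real.log n) ≤ 1 / 2) :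
    pr (fun ω : ProcSample H n => ¬ SmallSparse ω (upperTime n) (smallSize n)) ≤
      2 * sparseError k (Real.log n) := by
  refine pr_not_smallSparse_le h.pos hiso (by have := h.mul_le; omega)
    (h.two_mul_upperTime_le hiso) h.upperTime_le
    (z := 6 * Real.exp (-(⌊√(Real.log n)⌋₊ / 16))) (fun s hs => ?_) ?_ he
  · have h1 : (s : ℝ) ≤ 6 * smallSize n := by exact_mod_cast hs
    have h2 : (smallSize n : ℝ) ≤ _ := Nat.floor_le (by positivity)
    linarith
  · rw [sparseError]
    gcongr
    linarith [Nat.lt_floor_add_one √(Real.log n)]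

lemma expandTime_le (h : IsLarge k n) (he : √(Real.log n) ≤ 3 / 4 * Real.log n / k) :
    expandTime n ≤ lowerTime k n := by
  have hn := h.n_pos
  rw [lowerTime]
  refine Nat.le_floor ?_
  rw [expandTime, Nat.cast_mul]
  calc (n : ℝ) * ⌊√(Real.log n)⌋₊ ≤ n * (3 / 4 * Real.log n / k) := by
        gcongr
        exact (Nat.floor_le (Real.sqrt_nonneg _)).trans he
    _ = _ := by ring

/-- Large sets expand. -/
lemma pr_largeExpands_le (h : IsLarge k n) (hiso : ∀ v, (H.neighborSet v).Nonempty)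
    (hs : √(Real.log n) ≤ 3 / 4 * Real.log n / k) (he : expandError (Real.log n) ≤ 1 / 2) :
    pr (fun ω : ProcSample H n => ¬ LargeExpands ω (expandTime n) (smallSize n)) ≤
      2 * expandError (Real.log n) := by
  have hn := h.n_pos
  have h1 := h.expandTime_le hs
  have h2 := h.mul_lowerTime_le hiso
  refine pr_not_largeExpands_le h.pos hiso (by have := h.mul_le; omega) (by omega)
    (x := Real.exp (⌊√(Real.log n)⌋₊ / 16)) (Real.exp_pos _) (fun s hs => ?_) ?_ he
  · have h3 := (Nat.floor_lt (by positivity)).1 hs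
    rw [Real.exp_neg, inv_mul_lt_iff₀ (Real.exp_pos _)] at h3
    exact h3.le
  · rw [expandTime, Nat.cast_mul, expandError, ← Real.exp_nat_mul, ← Real.exp_add, ← Real.exp_add,
      Real.exp_le_exp]
    have h3 : (n : ℝ) * (⌊√(Real.log n)⌋₊ : ℝ) / (4 * n) = ⌊√(Real.log n)⌋₊ / 4 := by
      field_simp
    have := Nat.lt_floor_add_one √(Real.log n)
    rw [h3]
    push_cast
    linarith

/-- Sparse expanders have boosters. -/
lemma pr_boosted_le (h : IsLarge k n) (hiso : ∀ v, (H.neighborSet v).Nonempty)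
    (he : (√(Real.log n) + (12 * k + 3)) * (Real.log (Real.log n) + 1) + 9 ≤
      3 / 64 * (Real.log n / k)) :
    pr (fun ω : ProcSample H n => ¬ Boosted ω (lowerTime k n) (upperTime n)
      (expandTime n + n * (12 * k + 3))) ≤ Real.exp (-Real.log n) := by
  have hn := h.n_pos
  have hk := h.k_pos
  have hl := h.one_le_log
  have hn1 : (1 : ℝ) ≤ n := by exact_mod_cast (by have := h.le; omega : 1 ≤ n)
  have h1 := h.two_mul_upperTime_le hiso
  have h2 := h.mul_lowerTime_le hiso
  refine (pr_not_boosted_le h.pos hiso (by have := h.mul_le; omega) (by have := h.le; omega)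
    (by omega) (by omega) (x := (Real.log n)⁻¹) (by positivity) (inv_le_one_of_one_le₀ hl)).trans ?_
  have hu := h.upperTime_le
  have hlt := lt_lowerTime k n
  have hlog := Real.log_le_sub_one_of_pos hn
  set l := Real.log n
  set t := expandTime n + n * (12 * k + 3) with ht
  have hll : 0 ≤ Real.log l := Real.log_nonneg hl
  have h3 : (t : ℝ) ≤ n * (√l + (12 * k + 3)) := by
    rw [ht, expandTime]
    push_cast
    rw [mul_add (n : ℝ) √l]
    gcongr
    exact Nat.floor_le (Real.sqrt_nonneg _)
  have h4 : (l⁻¹ ^ t)⁻¹ = Real.exp (t * Real.log l) := by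
    rw [inv_pow, inv_inv, Real.exp_nat_mul, Real.exp_log (by linarith)]
  rw [h4, ← Real.exp_add, ← Real.exp_add, Real.exp_le_exp]
  have h5 : l⁻¹ * upperTime n ≤ 7 * n := by
    rw [inv_mul_le_iff₀ (by linarith)]
    linarith
  have h6 : (t : ℝ) * (Real.log l + 1 / 16) ≤ n * ((√l + (12 * k + 3)) * (Real.log l + 1)) := by
    rw [← mul_assoc]
    gcongr
    norm_num
  have h7 : 3 / 4 * n * l / k = 16 * (n * (3 / 64 * (l / k))) := by ring
  have h8 := mul_le_mul_of_nonneg_left he hn.le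
  rw [h7] at hlt
  linarith

end IsLarge

end Asymptotics

section Limit
variable {k : ℕ} {H : SimpleGraph (Fin k)}

open Asymptotics in
lemma eventually_mul_log_add_le (c : ℝ) {ε : ℝ} (hε : 0 < ε) :
    ∀ᶠ l : ℝ in atTop, (√l + c) * (Real.log l + 1) + 9 ≤ ε * l := by
  have hsqrt : Tendsto (fun l : ℝ => ‖√l‖) atTop atTop :=
    tendsto_norm_atTop_atTop.comp Real.tendsto_sqrt_atTop
  have h1 : (fun l : ℝ => √l + c) =O[atTop] fun l => √l :=
    (isBigO_refl _ _).add ((isLittleO_const_left.2 (Or.inr hsqrt)).isBigO)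
  have h2 : (fun l : ℝ => Real.log l + 1) =o[atTop] fun l => √l := by
    refine IsLittleO.add ?_ (isLittleO_const_left.2 (Or.inr hsqrt))
    simpa only [Real.sqrt_eq_rpow] using isLittleO_log_rpow_atTop (r := 1 / 2) (by norm_num)
  have h3 : (fun l : ℝ => (√l + c) * (Real.log l + 1) + 9) =o[atTop] fun l => √l * √l := by
    refine (h1.mul_isLittleO h2).add (isLittleO_const_left.2 (Or.inr ?_))
    refine tendsto_norm_atTop_atTop.comp (tendsto_id.congr' ?_)
    filter_upwards [eventually_ge_atTop 0] with l hl
    exact (Real.mul_self_sqrt hl).symm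
  filter_upwards [h3.def hε, eventually_ge_atTop 0] with l hl hl0
  rw [Real.mul_self_sqrt hl0, Real.norm_of_nonneg hl0] at hl
  exact (le_abs_self _).trans hl

lemma tendsto_lightError (k : ℕ) : Tendsto (lightError k) atTop (nhds 0) := by
  have h := (tendsto_rpow_mul_exp_neg_mul_atTop_nhds_zero (24 * k + 4 : ℕ) (13 / 32)
    (by norm_num)).const_mul (4 * (28 * (k : ℝ) ^ 2) ^ 4 * (24 * k * (28 * k ^ 2) ^ (24 * k)) *
      Real.exp 1)
  rw [mul_zero] at h
  refine h.congr fun l => ?_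
  rw [lightError, Real.rpow_natCast, sub_eq_add_neg, Real.exp_add, mul_pow _ l, mul_pow _ l,
    ← neg_mul]
  ring

lemma tendsto_sparseError (k : ℕ) : Tendsto (sparseError k) atTop (nhds 0) := by
  have h := ((tendsto_rpow_mul_exp_neg_mul_atTop_nhds_zero (4 : ℕ) (1 / 16)
    (by norm_num)).comp Real.tendsto_sqrt_atTop).const_mul
    (Real.exp 3 * k ^ 4 * 49 * (6 * Real.exp (1 / 16)))
  rw [mul_zero] at h
  refine h.congr' ?_
  filter_upwards [eventually_ge_atTop 0] with l hl
  have h1 : √l ^ 4 = l ^ 2 := by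
    rw [show 4 = 2 * 2 by norm_num, pow_mul, Real.sq_sqrt hl]
  have h2 : -((√l - 1) / 16) = 1 / 16 + -(1 / 16) * √l := by ring
  rw [Function.comp_apply, Real.rpow_natCast, h1, sparseError, h2, Real.exp_add]
  ring

lemma tendsto_expandError : Tendsto expandError atTop (nhds 0) := by
  refine Real.tendsto_exp_atBot.comp ?_
  refine (tendsto_atBot_add_const_left _ (3 + 1 / 16 : ℝ)
    (tendsto_neg_atTop_atBot.comp (Real.tendsto_sqrt_atTop.atTop_div_const
      (by norm_num : (0 : ℝ) < 16)))).congr fun l => ?_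
  rw [Function.comp_apply]
  ring

lemma tendsto_log_natCast : Tendsto (fun n : ℕ => Real.log n) atTop atTop :=
  Real.tendsto_log_atTop.comp tendsto_natCast_atTop_atTop

lemma eventually_isLarge (hk : 0 < k) : ∀ᶠ n in atTop, IsLarge k n := by
  have hk' : (0 : ℝ) < k := by exact_mod_cast hk
  have h := tendsto_natCast_atTop_atTop.eventually
    (Real.isLittleO_log_id_atTop.def (c := (28 * (k : ℝ) ^ 2)⁻¹) (by positivity))
  filter_upwards [h, tendsto_log_natCast.eventually_ge_atTop 1, eventually_ge_atTop (1000 * k ^ 2)]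
    with n h1 h2 h3
  refine ⟨hk, h2, h3, ?_⟩
  rw [id, Real.norm_of_nonneg (by linarith), Real.norm_of_nonneg (Nat.cast_nonneg _),
    inv_mul_eq_div, le_div_iff₀ (by positivity)] at h1
  linarith

lemma IsLarge.pr_tauHam_ne_le {n : ℕ} (h : IsLarge k n) (hiso : ∀ v, (H.neighborSet v).Nonempty)
    (hs : √(Real.log n) ≤ 3 / 4 * Real.log n / k)
    (hb : (√(Real.log n) + (12 * k + 3)) * (Real.log (Real.log n) + 1) + 9 ≤
      3 / 64 * (Real.log n / k))
    (h₁ : sparseError k (Real.log n) ≤ 1 / 2) (h₂ : expandError (Real.log n) ≤ 1 / 2) :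
    pr (fun ω : ProcSample H n => ¬ tauHam ω = tauDeg 2 ω) ≤
      Real.exp (-Real.log n) + (Real.exp (-(3 / 16 * Real.log n)) + (lightError k (Real.log n) +
        (2 * sparseError k (Real.log n) + (2 * expandError (Real.log n) +
          Real.exp (-Real.log n))))) := by
  refine le_trans (pr_mono fun ω hω => ?_) ((pr_or_le _ _).trans (add_le_add
    (h.pr_degree_le hiso) ((pr_or_le _ _).trans (add_le_add (h.pr_covered_le hiso)
    ((pr_or_le _ _).trans (add_le_add (h.pr_lightFar_le hiso) ((pr_or_le _ _).trans (add_le_add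
    (h.pr_smallSparse_le hiso h₁) ((pr_or_le _ _).trans (add_le_add (h.pr_largeExpands_le hiso hs h₂)
    (h.pr_boosted_le hiso hb)))))))))))
  by_contra hc
  push Not at hc
  obtain ⟨hdeg, hmiss, hfar, hsparse, hlarge, hboost⟩ := hc
  exact hω (tauHam_eq_tauDeg h.pos hiso (by have := h.le; omega) (h.expandTime_le hs) le_rfl
    hdeg hmiss hfar hsparse hlarge hboost)

end Limit

/-- **Theorem 7 (hitting time of Hamiltonicity).**  W.h.p. the random motif graph
process becomes Hamiltonian exactly when the minimum degree becomes `2`: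
`τ_H = τ_2`. -/
theorem hitting_time_hamiltonicity {k : ℕ} (H : SimpleGraph (Fin k)) (hk : 0 < k)
    (hiso : ∀ v, (H.neighborSet v).Nonempty) :
    Tendsto (fun n => procProb H n (fun ω => tauHam ω = tauDeg 2 ω))
      atTop (nhds 1) := by
  have hk' : (0 : ℝ) < k := by exact_mod_cast hk
  have hexp : ∀ c : ℝ, 0 < c → Tendsto (fun l : ℝ => Real.exp (-(c * l))) atTop (nhds 0) :=
    fun c hc => Real.tendsto_exp_neg_atTop_nhds_zero.comp (tendsto_id.const_mul_atTop hc)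
  have hexp1 := Real.tendsto_exp_neg_atTop_nhds_zero
  have hlim := (hexp1.add ((hexp (3 / 16) (by norm_num)).add ((tendsto_lightError k).add
    (((tendsto_sparseError k).const_mul 2).add ((tendsto_expandError.const_mul 2).add
      hexp1))))).comp tendsto_log_natCast
  simp only [mul_zero, add_zero] at hlim
  have hlim' := hlim.const_sub 1
  rw [sub_zero] at hlim'
  have hsqrt : ∀ᶠ l : ℝ in atTop, √l ≤ 3 / 4 * l / k := by
    filter_upwards [eventually_ge_atTop ((4 / 3 * (k : ℝ)) ^ 2)] with l hl
    have hl0 : 0 ≤ l := le_trans (by positivity) hl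
    have h1 := Real.le_sqrt_of_sq_le hl
    rw [le_div_iff₀ hk']
    nlinarith [Real.mul_self_sqrt hl0, Real.sqrt_nonneg l]
  refine tendsto_of_tendsto_of_tendsto_of_le_of_le' hlim' tendsto_const_nhds ?_
    (Eventually.of_forall fun n => pr_le_one _)
  filter_upwards [eventually_isLarge hk, tendsto_log_natCast.eventually hsqrt,
    tendsto_log_natCast.eventually (eventually_mul_log_add_le (12 * k + 3)
      (by positivity : 0 < 3 / 64 / (k : ℝ))),
    tendsto_log_natCast.eventually ((tendsto_sparseError k).eventually_le_const
      (by norm_num : (0 : ℝ) < 1 / 2)),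
    tendsto_log_natCast.eventually (tendsto_expandError.eventually_le_const
      (by norm_num : (0 : ℝ) < 1 / 2))] with n h1 h2 h3 h4 h5
  have h := h1.pr_tauHam_ne_le hiso h2 (h3.trans_eq (by ring)) h4 h5
  have hne : Nonempty (ProcSample H n) := inferInstance
  rw [pr_not] at h
  change 1 - _ ≤ pr _
  simp only [Function.comp_apply]
  linarith

end RandomMotif
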